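/- Let n = 2m be a positive even integer. There exists an m×m Toeplitz matrix A over F_2 such that the double Toeplitz code C(A) has minimum weight at least 10 if and only if n ≥ 42. -/

import Mathlib

open Matrix

/-- An `m × m` matrix is Toeplitz if its entries are constant along diagonals. -/
def IsToeplitz {m : ℕ} {F : Type*} (A : Matrix (Fin m) (Fin m) F) : Prop :=
  ∀ i j i' j' : Fin m, (i : ℕ) + (j' : ℕ) = (i' : ℕ) + (j : ℕ) → A i j = A i' j'

/-- The double Toeplitz code `C(A) = {(x, xA) : x ∈ F^m}`. -/
def DTcode {m : ℕ} {F : Type*} [Field F] (A : Matrix (Fin m) (Fin m) F) :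
    Set (Fin m ⊕ Fin m → F) :=
  {c | ∃ x : Fin m → F, c = Sum.elim x (Matrix.vecMul x A)}

/-- The Hamming weight of a vector: the number of nonzero coordinates. -/
noncomputable def wt {ι : Type*} [Fintype ι] {F : Type*} [Zero F] (v : ι → F) : ℕ :=
  Nat.card {i // v i ≠ 0}

namespace Sieve

/-! ### A sieve for binary sequences

The functions below are evaluated by the kernel, hence the explicit recursors. A *lane* is a
candidate for the first `R` terms of a sequence; numbers are read as tables whose base-32 digits
are indexed by the lanes. The terms from `R` on are the branchings of a binary tree, whose leaves
hold sets of lanes. -/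

inductive BitTree where
  | nil : BitTree
  | leaf (S : ℕ) : BitTree
  | node (l r : BitTree) : BitTree

namespace BitTree

noncomputable def size (t : BitTree) : ℕ :=
  BitTree.rec (motive := fun _ => ℕ) 0 (fun _ => 1) (fun _ _ a b => Nat.add a b) t

noncomputable def split (t : BitTree) : BitTree :=
  BitTree.rec (motive := fun _ => BitTree) nil (fun S => node (leaf S) (leaf S))
    (fun _ _ a b => node a b) t

noncomputable def shift (G : ℕ) (t : BitTree) : BitTree :=
  BitTree.rec (motive := fun _ => BitTree) nil (fun S => leaf (Nat.shiftRight S G))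
    (fun _ _ a b => node a b) t

end BitTree

/-- `force k n` is `k n`; the kernel evaluates `n` to a numeral before it unfolds `k`. -/
noncomputable def force {α : Type} (k : ℕ → α) (n : ℕ) : α :=
  Nat.rec (motive := fun _ => α) (k 0) (fun n _ => k (Nat.succ n)) n

/-- Remove from the leaves of `t` the lanes whose digit in the sum of `c` and the columns along
the branch is less than 16. The columns are those of `ys`, complemented according to the parity
`P` of the contribution of the branch. -/
noncomputable def prune (full x top : ℕ) (t : BitTree) : List ℕ → ℕ → ℕ → BitTree :=
  BitTree.rec (motive := fun _ => List ℕ → ℕ → ℕ → BitTree)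
    (fun _ _ _ => .nil)
    (fun S _ _ c => (fun S' => Bool.rec (.leaf S') .nil (Nat.beq S' 0)) (Nat.land S c))
    (fun _ _ l r ys P c => (fun y z ys => Nat.rec (motive := fun _ => BitTree)
        (.node (l ys (Nat.shiftLeft P 1) (Nat.add c y))
          (r ys (Nat.shiftLeft (Nat.xor P x) 1) (Nat.add c z)))
        (fun _ _ => .node (l ys (Nat.shiftLeft P 1) (Nat.add c z))
          (r ys (Nat.shiftLeft (Nat.xor P x) 1) (Nat.add c y)))
        (Nat.land P top)) (ys.headD 0) (Nat.xor full (ys.headD 0)) ys.tail)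
    t

noncomputable def xorWith (a : List ℕ) : List ℕ → List ℕ :=
  List.rec (motive := fun _ => List ℕ → List ℕ) (fun b => b)
    (fun h t ih b => List.rec (motive := fun _ => List ℕ) (h :: t)
      (fun h' b _ => Nat.xor h h' :: ih b) b) a

/-- The sum of `acc` and of the `H.drop i`, for the `i < n` with `x.testBit i`. -/
noncomputable def combine (n : ℕ) : ℕ → List ℕ → List ℕ → List ℕ :=
  Nat.rec (motive := fun _ => ℕ → List ℕ → List ℕ → List ℕ) (fun _ _ acc => acc)
    (fun _ ih x H acc => ih (Nat.shiftRight x 1) H.tail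
      (Nat.rec (motive := fun _ => List ℕ) acc (fun _ _ => xorWith H acc) (Nat.land x 1))) n

noncomputable def bitCount (n : ℕ) : ℕ → ℕ :=
  Nat.rec (motive := fun _ => ℕ → ℕ) (fun _ => 0)
    (fun _ ih x => Nat.add (Nat.land x 1) (ih (Nat.shiftRight x 1))) n

noncomputable def total (n : ℕ) (k : List ℕ → ℕ → BitTree) : List ℕ → ℕ → BitTree :=
  Nat.rec (motive := fun _ => List ℕ → ℕ → BitTree) k
    (fun _ ih ys c => ih ys.tail (Nat.add c (ys.headD 0))) n

noncomputable def test (full : ℕ) (H : List ℕ) (R L : ℕ) (t : BitTree) (x : ℕ) : BitTree :=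
  total (Nat.sub R L) (fun ys c => prune full x (Nat.shiftLeft 1 L) t ys 0 c)
    (combine (Nat.succ L) x H []) (Nat.mul full (Nat.add 6 (bitCount (Nat.succ L) x)))

noncomputable def testAll (full : ℕ) (H : List ℕ) (R L : ℕ) (ws : List ℕ)
    (k : BitTree → Bool) : BitTree → Bool :=
  List.rec (motive := fun _ => BitTree → Bool) k
    (fun x _ ih t => (fun t => Nat.rec (motive := fun _ => Bool) true (fun _ _ => ih t) t.size)
      (test full H R L t x)) ws

noncomputable def search (full : ℕ) (H : List ℕ) (R : ℕ) (wss : List (List ℕ))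
    (k : ℕ → BitTree → Bool) : ℕ → BitTree → Bool :=
  List.rec (motive := fun _ => ℕ → BitTree → Bool) k
    (fun ws _ ih L t => testAll full H R L ws (ih (Nat.succ L)) t.split) wss

/-- The number with bits `0, w, …, (2 ^ n - 1) * w`. -/
noncomputable def ones (w n : ℕ) : ℕ :=
  Nat.rec (motive := fun _ => ℕ) 1
    (fun i x => Nat.add x (Nat.shiftLeft x (Nat.shiftLeft w i))) n

/-! Candidates are stored as entries of 40 bits, whose last bit is set, in groups of at most eight
lists. A list is a number, whose entries are its digits. -/

noncomputable def groupColumn (mask j : ℕ) (Ps : List ℕ) : ℕ :=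
  List.rec (motive := fun _ => ℕ) 0
    (fun P _ ih => Nat.lor (Nat.land (Nat.shiftRight P j) mask) (Nat.shiftLeft ih 5)) Ps

noncomputable def column (mask G j : ℕ) (Pss : List (List ℕ)) : ℕ :=
  List.rec (motive := fun _ => ℕ) 0
    (fun Ps _ ih => Nat.lor (groupColumn mask j Ps) (Nat.shiftLeft ih G)) Pss

noncomputable def columns (mask G : ℕ) (Pss : List (List ℕ)) (R : ℕ) : ℕ → List ℕ :=
  Nat.rec (motive := fun _ => ℕ → List ℕ) (fun _ => [])
    (fun _ ih j => column mask G j Pss :: ih (Nat.succ j)) R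

/-- `Z` without the entries that precede the first one whose last bit is set. -/
noncomputable def normalize (mask Z : ℕ) : ℕ :=
  (fun M => Nat.div Z (Nat.sub M (Nat.land M (Nat.sub M 1))))
    (Nat.land (Nat.shiftRight Z 39) mask)

/-- Put the entries of `Z`, combined with `base`, in front of those of `Q`. -/
noncomputable def extract (mask base fuel : ℕ) : ℕ → ℕ → ℕ :=
  Nat.rec (motive := fun _ => ℕ → ℕ → ℕ) (fun _ Q => Q)
    (fun _ ih Z Q => Nat.rec (motive := fun _ => ℕ) Q
      (fun Z _ => (fun Z => force (force ih (normalize mask (Nat.shiftRight Z 40)))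
        (Nat.lor (Nat.shiftLeft Q 40)
          (Nat.land (Nat.lor base Z) (Nat.sub (Nat.shiftLeft 1 40) 1))))
        (Nat.succ Z)) Z) fuel

noncomputable def gather (mask gmask off P : ℕ) (t : BitTree) : ℕ → ℕ → ℕ → ℕ :=
  BitTree.rec (motive := fun _ => ℕ → ℕ → ℕ → ℕ) (fun _ _ Q => Q)
    (fun S _ base Q => force (fun Z => extract mask base Z Z Q)
      (normalize mask (Nat.land P (Nat.mul
        (Nat.land (Nat.shiftRight (Nat.land S gmask) off) mask)
        (Nat.sub (Nat.shiftLeft 1 40) 1)))))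
    (fun _ _ l r p base Q =>
      r (Nat.succ p) (Nat.lor base (Nat.shiftLeft 1 p)) (l (Nat.succ p) base Q)) t

noncomputable def groupRepack (mask gmask R : ℕ) (t : BitTree) (Ps : List ℕ) : ℕ → List ℕ :=
  List.rec (motive := fun _ => ℕ → List ℕ) (fun _ => [])
    (fun P _ ih off => gather mask gmask off P t R 0 0 :: ih (Nat.add off 5)) Ps

/-- The surviving candidates, together with the terms read off the branches. -/
noncomputable def repack (mask G gmask R : ℕ) (Pss : List (List ℕ)) : BitTree → List (List ℕ) :=
  List.rec (motive := fun _ => BitTree → List (List ℕ)) (fun _ => [])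
    (fun Ps _ ih t => groupRepack mask gmask R t Ps 4 :: ih (t.shift G)) Pss

noncomputable def union (Pss : List (List ℕ)) : ℕ :=
  List.rec (motive := fun _ => ℕ) 0 (fun Ps _ ih =>
    List.rec (motive := fun _ => ℕ) ih (fun P _ ih => Nat.lor P ih) Ps) Pss

noncomputable def depth (P : ℕ) : ℕ :=
  Nat.rec (motive := fun _ => ℕ) 0 (fun i ih =>
    Bool.rec (Nat.succ i) ih (Nat.beq (Nat.shiftRight P (Nat.shiftLeft 40 i)) 0)) 12

noncomputable def stage (n R : ℕ) (Pss : List (List ℕ)) (wss : List (List ℕ))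
    (k : ℕ → List (List ℕ) → Bool) (L : ℕ) : Bool :=
  (fun mask G => Bool.rec false
    ((fun full => search full (columns mask G Pss R 0) R wss
      (fun L t => k L (repack mask G (Nat.sub (Nat.shiftLeft 1 G) 1) R Pss t)) L
      (.leaf (Nat.shiftLeft full 4))) (column mask G 39 Pss))
    (Nat.beq (Nat.shiftRight (union Pss) G) 0)) (ones 40 n) (Nat.shiftLeft 40 n)

/-- Whether no candidate survives. The entry `L + i` of `wsss.flatten` lists words of degree
`L + i`. -/
noncomputable def stages (wsss : List (List (List ℕ))) : ℕ → List (List ℕ) → ℕ → Bool :=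
  List.rec (motive := fun _ => ℕ → List (List ℕ) → ℕ → Bool) (fun _ _ _ => false)
    (fun wss _ ih R Pss => stage (depth (union Pss)) R Pss wss (fun L Pss =>
      Nat.rec (motive := fun _ => Bool) true (fun _ _ => ih (Nat.add R wss.length) Pss L)
        (union Pss)))
    wsss

/-- A list of `2 ^ n` entries, the `k`-th of which is `base + k * 2 ^ b`. -/
noncomputable def packed (b n base : ℕ) : ℕ :=
  Nat.add (Nat.mul (ones 40 n) (Nat.add base (Nat.shiftLeft 1 39)))
    (Nat.shiftLeft (Nat.rec (motive := fun _ => ℕ) 0 (fun i x => Nat.add x (Nat.shiftLeft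
      (Nat.add x (Nat.shiftLeft (ones 40 i) i)) (Nat.shiftLeft 40 i))) n) b)

/-- All entries `base + a * 2 ^ b` with `a < 2 ^ 15`. -/
noncomputable def initial (b base : ℕ) : List (List ℕ) :=
  (List.range 8).map fun t => (List.range 8).map fun s =>
    packed (Nat.add b 6) 9 (Nat.add base (Nat.shiftLeft (Nat.add (Nat.mul 8 t) s) b))

def rootWords : List (List ℕ) :=
  [[1],
   [2, 3],
   [4, 5, 6, 7],
   [8, 9, 10, 11, 12, 13, 14, 15],
   [17, 25, 19, 21, 16, 29, 23, 18, 20, 28, 26, 24, 22, 27, 30, 31],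
   [33, 37, 41, 49, 35, 32, 53, 43, 39, 34, 57, 36, 48, 45, 50, 51, 38, 40, 52, 42, 44, 56, 47,
    61, 58, 59, 55, 46, 54],
   [65, 81, 69, 97, 67, 73, 64, 113, 71, 66, 89, 77, 68, 75, 105, 99, 72, 83, 80, 74, 85, 101,
    96, 82, 76, 84, 70, 98, 104, 100, 88, 112, 93, 87],
   [129, 133, 161, 131, 193, 145, 137, 128, 149, 169, 201, 144, 147, 209, 135, 177, 225, 132,
    130, 153, 139, 141, 163, 195, 197, 160, 138, 162, 165, 136, 134]]

def laterWords : List (List ℕ) :=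
  [[256, 257, 259, 385, 261, 321, 265, 273, 289, 384, 329, 305, 417, 275, 263, 449, 401, 281,
    280, 304, 293, 352, 277, 296, 328, 267, 297, 272, 337, 292, 388, 416, 336, 353, 400, 269,
    392, 258, 291, 389, 288, 264, 323, 393, 260, 320],
   [512, 513, 515, 769, 545, 529, 641, 521, 577, 517, 519, 897, 516, 649, 773, 581, 593, 609,
    548, 833, 785, 523, 673, 553, 547, 643, 533, 580, 537, 525, 561, 579, 644, 657, 531, 514,
    536, 705, 774, 777, 640, 648, 532, 772, 801, 771, 645],
   [1025, 1024, 1041, 1033, 1153, 1089, 1537, 1027, 1281, 1029, 1057, 1536, 1088, 1056, 1091,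
    1152, 1553, 1043, 1065, 1040, 1601, 1185, 1048, 1104, 1155, 1283, 1665, 1105, 1545, 1097,
    1035, 1031, 1792, 1169, 1028, 1541, 1793, 1157],
   [2049, 2048, 2081, 2113, 3075, 2057, 2305, 2561, 2065, 2177, 2064, 3073, 2560, 2051, 2053,
    2052, 2112, 2185, 2321, 2115, 3081, 3105, 2593, 3136, 3089, 3200, 2304, 2179, 2240, 2307,
    3329, 2312, 2309, 2340, 2569, 2098, 3137, 2117, 2129],
   [4096, 4097, 4113, 4224, 4225, 4129, 6144, 4161, 4352, 5121, 4609, 4105, 4160, 6273, 4641,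
    4625, 4131, 4233, 6208, 5125, 4361, 4617, 4288, 4137, 6145, 4194, 6177, 6161, 6160, 4362,
    5154, 5140, 5156, 4481, 4321, 6401, 4115, 4166, 4674, 4418, 4118, 4170, 4227, 4355, 5379,
    4868, 4145, 4292, 4422],
   [8192, 8193, 9216, 8321, 8224, 8208, 8256, 9280, 9224, 8225, 12321, 8352, 8198, 9233, 8328,
    8713, 9225, 8197, 8329, 8705, 8465, 12289, 9096, 8326, 9226, 9368, 8784, 10016, 10273, 8201,
    8259, 8770, 8296, 8483, 8331, 11536, 12577, 15368, 8737, 8977, 9221, 15361, 12417, 8912,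
    9281, 10884, 12418, 12836, 8490, 11344, 8449, 8532, 9292, 8408, 10448, 10818, 13072, 9008,
    8834, 9988, 11272, 8353, 8356, 8968, 9505, 9745, 8420, 8488, 8513, 8788, 13360, 8489, 9272,
    9800, 10253, 11304, 12464, 12840, 14656, 8235, 8249, 8753, 8852, 9258, 9476, 12370, 13377,
    8298, 8453, 9478, 10392, 10688, 10770, 8706, 10262, 12872, 8200, 8209, 9217, 8712, 8736,
    8772, 14340, 10816, 8195, 9248, 9728],
   [17425, 16384, 17539, 18563, 16913, 17475, 17441, 24849, 16672, 16584, 24706, 16901, 17280,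
    16385, 18628, 20992, 17409, 17411, 16424, 17418, 17432, 16391, 16401, 16426, 16428, 16454,
    16459, 16484, 16514, 16515, 16544, 16586, 18433]]

def shortWords : List (List ℕ) :=
  [[1],
   [2, 3],
   [4, 5, 6, 7],
   [8, 9, 10, 11, 12, 13, 14],
   [16, 17, 18, 19, 20, 21, 22, 24, 25, 26, 28],
   [32, 33, 34, 35, 36, 37, 38, 40, 41, 42, 44, 48, 49, 50, 52, 56]]

/-! ### Soundness of the sieve -/

/-- The sum of the `σ (j + i)` for the `i < n` with `x.testBit i`. -/
def conv : ℕ → ℕ → (ℕ → Bool) → ℕ → Bool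
  | 0, _, _, _ => false
  | n + 1, x, σ, j => (x.testBit 0 && σ j) ^^ conv n (x >>> 1) σ (j + 1)

/-- The sequence `σ`, cut off at `p`. -/
def trunc (p : ℕ) (σ : ℕ → Bool) (i : ℕ) : Bool := decide (i < p) && σ i

theorem conv_trunc_succ (n x : ℕ) (σ : ℕ → Bool) (p j : ℕ) :
    conv n x (trunc (p + 1) σ) j = (conv n x (trunc p σ) j ^^
      (σ p && (decide (j ≤ p) && (decide (p < j + n) && x.testBit (p - j))))) := by
  induction n generalizing x j with
  | zero =>
    by_cases h1 : j ≤ p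
    · simp [conv, show ¬ p < j by omega]
    · simp [conv, h1]
  | succ n ih =>
    simp only [conv, ih, trunc]
    rcases lt_trichotomy j p with h | h | h
    · have : p - j = 1 + (p - (j + 1)) := by omega
      have h1 : p < j + (n + 1) ↔ p < j + 1 + n := by omega
      simp [h, h.le, Nat.succ_le_of_lt h, h.trans (Nat.lt_succ_self p), this, h1]
    · subst h
      simp [Bool.and_comm, Bool.xor_comm]
    · simp [show ¬ j ≤ p by omega, show ¬ j < p by omega, show ¬ j < p + 1 by omega,
        show ¬ j + 1 ≤ p by omega]

theorem conv_congr {n : ℕ} (x : ℕ) {σ τ : ℕ → Bool} {j : ℕ}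
    (h : ∀ i, i < j + n → σ i = τ i) : conv n x σ j = conv n x τ j := by
  induction n generalizing x j with
  | zero => rfl
  | succ n ih => rw [conv, conv, h j (by omega), ih _ fun i hi => h i (by omega)]

/-- All the bits of `y` lie at multiples of 5. -/
def Flags (y : ℕ) : Prop := ∀ b, y.testBit b → 5 ∣ b

theorem Flags.zero : Flags 0 := by simp [Flags]

theorem Flags.xor {y z : ℕ} (hy : Flags y) (hz : Flags z) : Flags (y ^^^ z) := by
  intro b hb
  rw [Nat.testBit_xor] at hb
  rcases h : y.testBit b
  · exact hz b (by simpa [h] using hb)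
  · exact hy b h

/-- The base-32 digits of `c` are the values of `f`. -/
def Rep (c : ℕ) (f : ℕ → ℕ) : Prop := ∀ v, c / 32 ^ v % 32 = f v

theorem add_div_of_mod_lt (c d v : ℕ) (f g : ℕ → ℕ) (hc : Rep c f) (hd : Rep d g)
    (h : ∀ w, f w + g w < 32) : (c + d) / 32 ^ v = c / 32 ^ v + d / 32 ^ v := by
  induction v with
  | zero => simp
  | succ v ih =>
    rw [pow_succ, ← Nat.div_div_eq_div_mul, ih, ← Nat.div_div_eq_div_mul, ← Nat.div_div_eq_div_mul]
    have := hc v; have := hd v; have := h v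
    omega

theorem Rep.add {c d : ℕ} {f g : ℕ → ℕ} (hc : Rep c f) (hd : Rep d g)
    (h : ∀ w, f w + g w < 32) : Rep (c + d) fun v => f v + g v := by
  intro v
  rw [add_div_of_mod_lt c d v f g hc hd h]
  have := hc v; have := hd v; have := h v
  dsimp only
  omega

theorem Flags.rep {y : ℕ} (hy : Flags y) : Rep y fun v => (y.testBit (5 * v)).toNat := by
  intro v
  have key : ∀ b, 0 < b → b < 5 → y.testBit (5 * v + b) = false := fun b h0 h5 => by
    by_contra h
    have := hy _ (by simpa using h)
    omega
  have e : (32 : ℕ) ^ v = 2 ^ (5 * v) := by rw [pow_mul]; norm_num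
  apply Nat.eq_of_testBit_eq
  intro i
  rw [e, show 32 = 2 ^ 5 by rfl, Nat.testBit_mod_two_pow, Nat.testBit_div_two_pow]
  rcases i with _ | i
  · cases h : y.testBit (5 * v) <;> simp [h]
  · have : (y.testBit (5 * v)).toNat.testBit (i + 1) = false := by
      apply Nat.testBit_eq_false_of_lt
      calc _ < 2 := Bool.toNat_lt _
        _ ≤ 2 ^ (i + 1) := by rw [pow_succ]; have := Nat.one_le_two_pow (n := i); omega
    rw [this]
    by_cases hi : i + 1 < 5
    · rw [add_comm (i + 1), key _ (by omega) hi]; simp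
    · simp [hi]

theorem Rep.zero : Rep 0 fun _ => 0 := by intro v; simp

theorem Flags.rep_mul {y : ℕ} (hy : Flags y) {k : ℕ} (hk : k < 32) :
    Rep (y * k) fun v => (y.testBit (5 * v)).toNat * k := by
  induction k with
  | zero => simpa using Rep.zero
  | succ k ih =>
    have := (ih (by omega)).add hy.rep fun w => by
      cases y.testBit (5 * w) <;> simp; omega
    simpa [Nat.mul_succ] using this

theorem Rep.testBit {c : ℕ} {f : ℕ → ℕ} (h : Rep c f) {v : ℕ} (hv : 16 ≤ f v) :
    c.testBit (5 * v + 4) := by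
  have e : (32 : ℕ) ^ v = 2 ^ (5 * v) := by rw [pow_mul]; norm_num
  have h1 := h v
  have : (c / 32 ^ v % 32).testBit 4 = true := by
    rw [h1]
    have : f v < 32 := by rw [← h1]; omega
    interval_cases f v <;> simp_all <;> decide
  rw [e, show 32 = 2 ^ 5 by rfl, Nat.testBit_mod_two_pow, Nat.testBit_div_two_pow, add_comm] at this
  simpa using this

/-- The lane `v` belongs to the leaf of `t` at depth `d` on the branch that `σ` follows from the
position `p` on. -/
def Mem (σ : ℕ → Bool) (v : ℕ) : ℕ → ℕ → BitTree → Prop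
  | 0, _, .leaf S => S.testBit (5 * v + 4)
  | d + 1, p, .node l r => if σ p then Mem σ v d (p + 1) r else Mem σ v d (p + 1) l
  | _, _, _ => False

theorem Mem.size_pos {σ : ℕ → Bool} {v d p : ℕ} {t : BitTree} (h : Mem σ v d p t) :
    t.size ≠ 0 := by
  induction t generalizing d p with
  | nil => cases d <;> simp [Mem] at h
  | leaf S => exact one_ne_zero
  | node l r ihl ihr =>
    cases d with
    | zero => simp [Mem] at h
    | succ d =>
      rw [Mem] at h
      change l.size + r.size ≠ 0
      split_ifs at h with hp
      · have := ihr h; omega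
      · have := ihl h; omega

theorem Mem.split {σ : ℕ → Bool} {v d p : ℕ} {t : BitTree} (h : Mem σ v d p t) :
    Mem σ v (d + 1) p t.split := by
  induction t generalizing d p with
  | nil => cases d <;> simp [Mem] at h
  | leaf S =>
    cases d with
    | zero => change Mem σ v 1 p (.node (.leaf S) (.leaf S)); simpa [Mem] using h
    | succ d => simp [Mem] at h
  | node l r ihl ihr =>
    cases d with
    | zero => simp [Mem] at h
    | succ d =>
      rw [Mem] at h
      change Mem σ v (d + 2) p (.node l.split r.split)
      rw [Mem]
      split_ifs at h ⊢ with hp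
      · exact ihr h
      · exact ihl h

theorem Mem.shift {σ : ℕ → Bool} {v d p g : ℕ} {t : BitTree} (h : Mem σ (v + g) d p t) :
    Mem σ v d p (t.shift (5 * g)) := by
  induction t generalizing d p with
  | nil => cases d <;> simp [Mem] at h
  | leaf S =>
    cases d with
    | zero =>
      change Mem σ v 0 p (.leaf (S >>> (5 * g)))
      rw [Mem] at h ⊢
      rw [Nat.testBit_shiftRight]
      convert h using 2
      ring
    | succ d => simp [Mem] at h
  | node l r ihl ihr =>
    cases d with
    | zero => simp [Mem] at h
    | succ d =>
      rw [Mem] at h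
      change Mem σ v (d + 1) p (.node (l.shift _) (r.shift _))
      rw [Mem]
      split_ifs at h ⊢ with hp
      · exact ihr h
      · exact ihl h

theorem mem_prune {σ : ℕ → Bool} {v full x L : ℕ} (hfull : Flags full)
    (hv : full.testBit (5 * v)) (hx : x.testBit L) {t : BitTree} {d j : ℕ} {ys : List ℕ}
    {P c B : ℕ} {f : ℕ → ℕ} (ht : Mem σ v d (j + L) t) (hys : ∀ i, Flags (ys.getD i 0))
    (hc : Rep c f) (hf : ∀ w, f w ≤ B) (hB : B + d ≤ 31)
    (hconv : ∀ i, conv (L + 1) x (trunc (j + L) σ) (j + i) =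
      ((ys.getD i 0).testBit (5 * v) ^^ (P <<< i).testBit L))
    (hwt : 16 ≤ f v + Nat.count (fun i => conv (L + 1) x σ (j + i)) d) :
    Mem σ v d (j + L) (prune full x (1 <<< L) t ys P c) := by
  induction t generalizing d j ys P c B f with
  | nil => cases d <;> simp [Mem] at ht
  | leaf S =>
    cases d with
    | zero =>
      rw [Mem] at ht
      have hb : (S &&& c).testBit (5 * v + 4) := by
        rw [Nat.testBit_and, ht, hc.testBit (by simpa using hwt)]; rfl
      have h0 : (S &&& c) ≠ 0 := by rintro h; simp [h] at hb
      change Mem σ v 0 _ (Bool.rec (BitTree.leaf (S &&& c)) .nil (Nat.beq (S &&& c) 0))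
      cases h : Nat.beq (S &&& c) 0
      · exact hb
      · exact absurd (Nat.eq_of_beq_eq_true h) h0
    | succ d => simp [Mem] at ht
  | node l r ihl ihr =>
    cases d with
    | zero => simp [Mem] at ht
    | succ d =>
      set y := ys.headD 0 with hy
      have hy0 : y = ys.getD 0 0 := by cases ys <;> rfl
      have htl : ∀ i, ys.tail.getD i 0 = ys.getD (i + 1) 0 := by
        intro i; cases ys <;> rfl
      have hyF : Flags y := hy0 ▸ hys 0
      have hzF : Flags (full ^^^ y) := hfull.xor hyF
      have hz : (full ^^^ y).testBit (5 * v) = !y.testBit (5 * v) := by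
        rw [Nat.testBit_xor, hv]; simp
      have hP : (P <<< 0).testBit L = P.testBit L := by simp
      have hcol : conv (L + 1) x σ (j + 0) =
          ((y.testBit (5 * v) ^^ P.testBit L) ^^ σ (j + L)) := by
        rw [hy0, ← hP, ← hconv 0, conv_congr x (τ := trunc (j + L + 1) σ), conv_trunc_succ]
        · simp [hx]
        · intro i hi
          simp [trunc, show i < j + L + 1 by omega]
      rw [Nat.count_succ', hcol] at hwt
      have hcount : (fun i => conv (L + 1) x σ (j + (i + 1)) = true) =
          fun i => conv (L + 1) x σ (j + 1 + i) = true := by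
        funext i; rw [add_assoc, add_comm 1]
      simp only [hcount] at hwt
      have hadd : ∀ u, Flags u → Rep (c + u) fun w => f w + (u.testBit (5 * w)).toNat :=
        fun u hu => hc.add hu.rep fun w => by
          have := hf w; have := Bool.toNat_le (u.testBit (5 * w)); omega
      have hle : ∀ (u w : ℕ), f w + (u.testBit (5 * w)).toNat ≤ B + 1 := fun u w => by
          have := hf w; have := Bool.toNat_le (u.testBit (5 * w)); omega
      have hconv0 : σ (j + L) = false → ∀ i, conv (L + 1) x (trunc (j + 1 + L) σ) (j + 1 + i) =
          ((ys.tail.getD i 0).testBit (5 * v) ^^ ((P <<< 1) <<< i).testBit L) := by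
        intro hσ i
        rw [htl, add_right_comm j 1 L, conv_trunc_succ, hσ, add_assoc j 1 i, add_comm 1 i, hconv,
          ← Nat.shiftLeft_add, add_comm 1 i]
        simp
      have hconv1 : σ (j + L) = true → ∀ i, conv (L + 1) x (trunc (j + 1 + L) σ) (j + 1 + i) =
          ((ys.tail.getD i 0).testBit (5 * v) ^^ (((P ^^^ x) <<< 1) <<< i).testBit L) := by
        intro hσ i
        rw [htl, add_right_comm j 1 L, conv_trunc_succ, hσ, add_assoc j 1 i, add_comm 1 i, hconv,
          ← Nat.shiftLeft_add, add_comm 1 i]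
        simp only [Nat.testBit_shiftLeft, Nat.testBit_xor]
        have e : j + L - (j + (i + 1)) = L - (i + 1) := by omega
        have e' : j + (i + 1) ≤ j + L ↔ i + 1 ≤ L := by omega
        have e2 : j + L < j + (i + 1) + (L + 1) := by omega
        rw [e]
        by_cases hi : i + 1 ≤ L <;> simp [e', hi, e2]
      rw [Mem, add_right_comm j L 1] at ht
      have hprune : prune full x (1 <<< L) (.node l r) ys P c =
          if P.testBit L then
            .node (prune full x (1 <<< L) l ys.tail (P <<< 1) (c + (full ^^^ y)))
              (prune full x (1 <<< L) r ys.tail ((P ^^^ x) <<< 1) (c + y))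
          else .node (prune full x (1 <<< L) l ys.tail (P <<< 1) (c + y))
              (prune full x (1 <<< L) r ys.tail ((P ^^^ x) <<< 1) (c + (full ^^^ y))) := by
        have hbit : P &&& 1 <<< L = 0 ↔ P.testBit L = false := by
          rw [Nat.one_shiftLeft, Nat.and_two_pow]
          cases P.testBit L <;> simp
        change Nat.rec (motive := fun _ => BitTree) _ _ (P &&& 1 <<< L) = _
        cases hPL : P.testBit L
        · rw [hbit.2 hPL]; rfl
        · obtain ⟨k, hk⟩ := Nat.exists_eq_succ_of_ne_zero (n := P &&& 1 <<< L)
            (fun h => by simp [hbit.1 h] at hPL)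
          rw [hk]; rfl
      rw [hprune]
      have hnode : ∀ l' r', (σ (j + L) = false → Mem σ v d (j + 1 + L) l') →
          (σ (j + L) = true → Mem σ v d (j + 1 + L) r') →
          Mem σ v (d + 1) (j + L) (.node l' r') := by
        intro l' r' h0 h1
        rw [Mem, add_right_comm j L 1]
        split_ifs with hσ
        · exact h1 hσ
        · exact h0 (by simpa using hσ)
      cases hPL : P.testBit L <;> rw [hPL] at hwt <;>
        simp only [Bool.false_eq_true, if_false, if_true] <;> apply hnode <;> intro hσ <;>
        rw [hσ] at ht hwt
      · refine ihl (by simpa using ht) (fun i => htl i ▸ hys _) (hadd _ hyF) (hle _) (by omega)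
          (hconv0 hσ) ?_
        cases hb : y.testBit (5 * v) <;> simp [hb] at hwt ⊢ <;> omega
      · refine ihr (by simpa using ht) (fun i => htl i ▸ hys _) (hadd _ hzF) (hle _) (by omega)
          (hconv1 hσ) ?_
        rw [hz]
        cases hb : y.testBit (5 * v) <;> simp [hb] at hwt ⊢ <;> omega
      · refine ihl (by simpa using ht) (fun i => htl i ▸ hys _) (hadd _ hzF) (hle _) (by omega)
          (hconv0 hσ) ?_
        rw [hz]
        cases hb : y.testBit (5 * v) <;> simp [hb] at hwt ⊢ <;> omega
      · refine ihr (by simpa using ht) (fun i => htl i ▸ hys _) (hadd _ hyF) (hle _) (by omega)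
          (hconv1 hσ) ?_
        cases hb : y.testBit (5 * v) <;> simp [hb] at hwt ⊢ <;> omega

theorem conv_add (n x : ℕ) (σ : ℕ → Bool) (a j : ℕ) :
    conv n x (fun p => σ (p + a)) j = conv n x σ (j + a) := by
  induction n generalizing x j with
  | zero => rfl
  | succ n ih => rw [conv, conv, ih, add_right_comm]

theorem conv_false (n x j : ℕ) : conv n x (fun _ => false) j = false := by
  induction n generalizing x j with
  | zero => rfl
  | succ n ih => simp [conv, ih]

theorem getD_xorWith (a b : List ℕ) (i : ℕ) :
    (xorWith a b).getD i 0 = a.getD i 0 ^^^ b.getD i 0 := by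
  induction a generalizing b i with
  | nil => change b.getD i 0 = _; simp
  | cons h a ih =>
    cases b with
    | nil => change (h :: a).getD i 0 = _; simp
    | cons h' b =>
      change ((h ^^^ h') :: xorWith a b).getD i 0 = _
      cases i with
      | zero => rfl
      | succ i => exact ih b i

theorem testBit_combine (n x : ℕ) (H acc : List ℕ) (i b : ℕ) :
    ((combine n x H acc).getD i 0).testBit b =
      ((acc.getD i 0).testBit b ^^ conv n x (fun p => (H.getD p 0).testBit b) i) := by
  induction n generalizing x H acc with
  | zero => simp [combine, conv]
  | succ n ih =>
    have htl : ∀ p, H.tail.getD p 0 = H.getD (p + 1) 0 := by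
      intro p; cases H <;> rfl
    have hstep : combine (n + 1) x H acc = combine n (x >>> 1) H.tail
        (if x.testBit 0 then xorWith H acc else acc) := by
      change combine n (x >>> 1) H.tail (Nat.rec (motive := fun _ => List ℕ) acc
        (fun _ _ => xorWith H acc) (x &&& 1)) = _
      rw [Nat.testBit_zero, Nat.and_one_is_mod]
      rcases Nat.mod_two_eq_zero_or_one x with h | h <;> rw [h] <;> rfl
    rw [hstep, ih, conv]
    simp only [htl]
    rw [conv_add n (x >>> 1) (fun p => (H.getD p 0).testBit b) 1 i]
    split_ifs with h0
    · rw [getD_xorWith, Nat.testBit_xor, h0, Bool.true_and, Bool.xor_comm (Nat.testBit _ _),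
        Bool.xor_assoc]
    · simp [h0]

theorem Flags.combine {H acc : List ℕ} (hH : ∀ i, Flags (H.getD i 0))
    (hacc : ∀ i, Flags (acc.getD i 0)) (n x i : ℕ) : Flags ((combine n x H acc).getD i 0) := by
  intro b hb
  by_contra h
  rw [testBit_combine] at hb
  have h1 : ∀ p, (H.getD p 0).testBit b = false := fun p => by
    by_contra h'; exact h (hH p b (by simpa using h'))
  have h2 : (acc.getD i 0).testBit b = false := by
    by_contra h'; exact h (hacc i b (by simpa using h'))
  simp only [h1, h2, conv_false] at hb
  simp at hb

theorem total_spec (v : ℕ) (k : List ℕ → ℕ → BitTree) (n : ℕ) {ys : List ℕ}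
    (hys : ∀ i, Flags (ys.getD i 0)) {c B : ℕ} {f : ℕ → ℕ} (hc : Rep c f) (hf : ∀ w, f w ≤ B)
    (hB : B + n ≤ 31) :
    ∃ ys' c' f', total n k ys c = k ys' c' ∧ (∀ i, ys'.getD i 0 = ys.getD (n + i) 0) ∧
      Rep c' f' ∧ (∀ w, f' w ≤ B + n) ∧
      f' v = f v + Nat.count (fun i => (ys.getD i 0).testBit (5 * v) = true) n := by
  induction n generalizing ys c B f with
  | zero => exact ⟨ys, c, f, rfl, by simp, hc, hf, by simp⟩
  | succ n ih =>
    have htl : ∀ i, ys.tail.getD i 0 = ys.getD (i + 1) 0 := by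
      intro i; cases ys <;> rfl
    have hy0 : ys.headD 0 = ys.getD 0 0 := by cases ys <;> rfl
    have hle : ∀ w, f w + ((ys.getD 0 0).testBit (5 * w)).toNat ≤ B + 1 := fun w => by
      have := hf w; have := Bool.toNat_le ((ys.getD 0 0).testBit (5 * w)); omega
    obtain ⟨ys', c', f', h, hys', hc', hf', hv⟩ := ih (ys := ys.tail) (fun i => htl i ▸ hys _)
      (hc.add (hys 0).rep fun w => by have := hle w; omega) hle (by omega)
    refine ⟨ys', c', f', ?_, fun i => ?_, hc', fun w => ?_, ?_⟩
    · rw [← h, ← hy0]; rfl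
    · rw [hys', htl]; congr 1; omega
    · have := hf' w; omega
    · rw [hv, Nat.count_succ']
      simp only [htl]
      cases (ys.getD 0 0).testBit (5 * v) <;> simp; omega

/-- The word `x` of degree `L` and its multiple by the block of `M` columns given by `σ` have
weight at least 10 in total. -/
def Good (σ : ℕ → Bool) (M L x : ℕ) : Prop :=
  10 ≤ bitCount (L + 1) x + Nat.count (fun j => conv (L + 1) x σ j = true) M

theorem mem_test {σ : ℕ → Bool} {v full R L d x : ℕ} {H : List ℕ} {t : BitTree}
    (hfull : Flags full) (hv : full.testBit (5 * v)) (hH : ∀ i, Flags (H.getD i 0))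
    (hHv : ∀ p, (H.getD p 0).testBit (5 * v) = trunc R σ p) (hx : x.testBit L)
    (hb : bitCount (L + 1) x ≤ 5) (hL : L ≤ R) (hM : R - L + d ≤ 20)
    (hgood : Good σ (R - L + d) L x) (ht : Mem σ v d R t) :
    Mem σ v d R (test full H R L t x) := by
  have hFl : ∀ i, Flags ((combine (L + 1) x H []).getD i 0) :=
    Flags.combine hH (by simp [Flags.zero]) _ _
  have hbit : ∀ i, ((combine (L + 1) x H []).getD i 0).testBit (5 * v) =
      conv (L + 1) x (trunc R σ) i := fun i => by
    rw [testBit_combine]; simp [funext hHv, -List.getD_eq_getElem?_getD]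
  have hrep := hfull.rep_mul (k := 6 + bitCount (L + 1) x) (by omega)
  obtain ⟨ys', c', f', h, hys', hc', hf', hfv⟩ := total_spec v
    (fun ys c => prune full x (1 <<< L) t ys 0 c) (R - L) hFl hrep
    (B := 11) (fun w => by cases full.testBit (5 * w) <;> simp; omega) (by omega)
  change Mem σ v d R (total (R - L) (fun ys c => prune full x (1 <<< L) t ys 0 c)
    (combine (L + 1) x H []) (full * (6 + bitCount (L + 1) x)))
  rw [h]
  have hR : R - L + L = R := Nat.sub_add_cancel hL
  have := mem_prune (j := R - L) (ys := ys') (P := 0) (c := c') (f := f') (B := 11 + (R - L))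
    hfull hv hx (by rwa [hR]) (fun i => hys' i ▸ hFl _) hc' hf' (by omega)
    (fun i => by rw [hR, hys', hbit]; simp) (by
      rw [hfv, hv]
      simp only [hbit]
      rw [Good, Nat.count_add] at hgood
      have : Nat.count (fun i => conv (L + 1) x (trunc R σ) i = true) (R - L) =
          Nat.count (fun i => conv (L + 1) x σ i = true) (R - L) := by
        rw [Nat.count_eq_card_filter_range, Nat.count_eq_card_filter_range]
        congr 1
        apply Finset.filter_congr
        intro i hi
        rw [conv_congr x]
        intro p hp
        have := Finset.mem_range.1 hi
        simp [trunc, show p < R by omega]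
      rw [this]
      simp
      omega)
  rwa [hR] at this

/-- The conditions on `σ` imposed by the words in the lists, the first of which consists of words
of degree `L`. -/
def Accepts (σ : ℕ → Bool) (M : ℕ) : ℕ → List (List ℕ) → Prop
  | _, [] => True
  | L, ws :: wss => (∀ x ∈ ws, x.testBit L ∧ bitCount (L + 1) x ≤ 5 ∧ Good σ M L x) ∧
      Accepts σ M (L + 1) wss

theorem mem_testAll {σ : ℕ → Bool} {v full R L d : ℕ} {H ws : List ℕ}
    {k : BitTree → Bool} {t : BitTree} (hfull : Flags full) (hv : full.testBit (5 * v))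
    (hH : ∀ i, Flags (H.getD i 0)) (hHv : ∀ p, (H.getD p 0).testBit (5 * v) = trunc R σ p)
    (hL : L ≤ R) (hM : R - L + d ≤ 20)
    (hws : ∀ x ∈ ws, x.testBit L ∧ bitCount (L + 1) x ≤ 5 ∧ Good σ (R - L + d) L x)
    (ht : Mem σ v d R t) (h : testAll full H R L ws k t = true) :
    ∃ t', Mem σ v d R t' ∧ k t' = true := by
  induction ws generalizing t with
  | nil => exact ⟨t, ht, h⟩
  | cons x ws ih =>
    obtain ⟨h1, h2, h3⟩ := hws x (by simp)
    have hm := mem_test hfull hv hH hHv h1 h2 hL hM h3 ht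
    refine ih (fun x hx => hws x (by simp [hx])) hm ?_
    obtain ⟨s, hs⟩ := Nat.exists_eq_succ_of_ne_zero hm.size_pos
    change Nat.rec (motive := fun _ => Bool) true (fun _ _ => testAll full H R L ws k _)
      (test full H R L t x).size = true at h
    rw [hs] at h
    exact h

theorem mem_search {σ : ℕ → Bool} {v full R L d M : ℕ} {H : List ℕ} {wss : List (List ℕ)}
    {k : ℕ → BitTree → Bool} {t : BitTree} (hfull : Flags full) (hv : full.testBit (5 * v))
    (hH : ∀ i, Flags (H.getD i 0)) (hHv : ∀ p, (H.getD p 0).testBit (5 * v) = trunc R σ p)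
    (hL : L + wss.length ≤ R) (hM : M ≤ 20) (hd : R + d + 1 = L + M)
    (hwss : Accepts σ M L wss) (ht : Mem σ v d R t) (h : search full H R wss k L t = true) :
    ∃ t', Mem σ v (d + wss.length) R t' ∧ k (L + wss.length) t' = true := by
  induction wss generalizing t L d with
  | nil => exact ⟨t, ht, h⟩
  | cons ws wss ih =>
    rw [List.length_cons] at hL
    obtain ⟨t', ht', h'⟩ := mem_testAll (d := d + 1) hfull hv hH hHv (by omega) (by omega)
      (by rw [show R - L + (d + 1) = M by omega]; exact hwss.1) ht.split h
    obtain ⟨t'', ht'', h''⟩ := ih (by omega) (by omega) hwss.2 ht' h'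
    refine ⟨t'', ?_, ?_⟩
    · rwa [List.length_cons, add_comm wss.length, ← add_assoc]
    · rwa [List.length_cons, add_comm wss.length, ← add_assoc]

theorem force_eq {α : Type} (k : ℕ → α) (n : ℕ) : force k n = k n := by cases n <;> rfl

theorem testBit_ones (w n b : ℕ) (hw : 0 < w) :
    (ones w n).testBit b = true ↔ ∃ k < 2 ^ n, b = w * k := by
  induction n generalizing b with
  | zero =>
    change (1 : ℕ).testBit b = true ↔ _
    simp [Nat.testBit_one_eq_true_iff_self_eq_zero]
  | succ n ih =>
    have hlt : ones w n < 2 ^ (w * 2 ^ n) := by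
      apply Nat.lt_pow_two_of_testBit
      intro i hi
      by_contra h
      obtain ⟨k, hk, rfl⟩ := (ih i).1 (by simpa using h)
      exact absurd (Nat.mul_lt_mul_of_pos_left hk hw) (by omega)
    have e : ones w (n + 1) = 2 ^ (w * 2 ^ n) * ones w n + ones w n := by
      change ones w n + ones w n <<< (w <<< n) = _
      rw [Nat.shiftLeft_eq, Nat.shiftLeft_eq]
      ring
    rw [e, Nat.testBit_two_pow_mul_add _ hlt]
    split_ifs with h
    · rw [ih]
      refine ⟨fun ⟨k, hk, e⟩ => ⟨k, by rw [pow_succ]; omega, e⟩, fun ⟨k, _, e⟩ => ⟨k, ?_, e⟩⟩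
      exact Nat.lt_of_mul_lt_mul_left (e ▸ h)
    · rw [ih]
      constructor
      · rintro ⟨k, hk, e⟩
        exact ⟨k + 2 ^ n, by rw [pow_succ]; omega, by rw [mul_add]; omega⟩
      · rintro ⟨k, hk, rfl⟩
        have hk' : 2 ^ n ≤ k := Nat.le_of_mul_le_mul_left (not_lt.1 h) hw
        rw [pow_succ] at hk
        exact ⟨k - 2 ^ n, by omega, by rw [Nat.mul_sub]⟩

section Columns

variable {n : ℕ}

theorem testBit_groupColumn {j : ℕ} {Ps : List ℕ} {b : ℕ}
    (h : (groupColumn (ones 40 n) j Ps).testBit b) :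
    ∃ k < 2 ^ n, ∃ r < Ps.length, b = 40 * k + 5 * r := by
  induction Ps generalizing b with
  | nil => change (0 : ℕ).testBit b = true at h; simp at h
  | cons P Ps ih =>
    change ((P >>> j &&& ones 40 n) ||| groupColumn (ones 40 n) j Ps <<< 5).testBit b = true at h
    rw [Nat.testBit_or, Bool.or_eq_true, Nat.testBit_and, Bool.and_eq_true,
      testBit_ones _ _ _ (by norm_num), Nat.testBit_shiftLeft, Bool.and_eq_true,
      decide_eq_true_iff] at h
    obtain ⟨-, k, hk, rfl⟩ | ⟨h5, h⟩ := h
    · exact ⟨k, hk, 0, by simp, by simp⟩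
    · obtain ⟨k, hk, r, hr, e⟩ := ih h
      exact ⟨k, hk, r + 1, by simpa using hr, by omega⟩

theorem testBit_groupColumn_lane {j : ℕ} {Ps : List ℕ} (hPs : Ps.length ≤ 8) {k r P : ℕ}
    (hk : k < 2 ^ n) (hr : Ps[r]? = some P) :
    (groupColumn (ones 40 n) j Ps).testBit (40 * k + 5 * r) = P.testBit (40 * k + j) := by
  induction Ps generalizing r with
  | nil => simp at hr
  | cons P' Ps ih =>
    change ((P' >>> j &&& ones 40 n) ||| groupColumn (ones 40 n) j Ps <<< 5).testBit _ = _
    rw [Nat.testBit_or, Nat.testBit_and, Nat.testBit_shiftLeft, Nat.testBit_shiftRight]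
    have hlen : (P' :: Ps).length = Ps.length + 1 := rfl
    cases r with
    | zero =>
      obtain rfl : P' = P := by simpa using hr
      have h1 : (ones 40 n).testBit (40 * k + 5 * 0) = true :=
        (testBit_ones _ _ _ (by norm_num)).2 ⟨k, hk, by simp⟩
      have h2 : (decide (40 * k + 5 * 0 ≥ 5) &&
          (groupColumn (ones 40 n) j Ps).testBit (40 * k + 5 * 0 - 5)) = false := by
        by_contra h
        rw [Bool.not_eq_false, Bool.and_eq_true, decide_eq_true_iff] at h
        obtain ⟨k', -, r, hr', e⟩ := testBit_groupColumn h.2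
        omega
      rw [h1, h2, add_comm j]
      simp
    | succ r =>
      have hr1 : Ps[r]? = some P := by simpa using hr
      obtain ⟨hr2, -⟩ := List.getElem?_eq_some_iff.1 hr1
      have h1 : (ones 40 n).testBit (40 * k + 5 * (r + 1)) = false := by
        by_contra h
        rw [Bool.not_eq_false, testBit_ones _ _ _ (by norm_num)] at h
        obtain ⟨k', -, e⟩ := h
        omega
      rw [h1, show 40 * k + 5 * (r + 1) - 5 = 40 * k + 5 * r by omega, ih (by omega) hr1]
      simp
      intro _
      omega

theorem flags_column (j : ℕ) (Pss : List (List ℕ)) :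
    Flags (column (ones 40 n) (40 <<< n) j Pss) := by
  induction Pss with
  | nil => exact Flags.zero
  | cons Ps Pss ih =>
    intro b hb
    change (groupColumn (ones 40 n) j Ps ||| column (ones 40 n) (40 <<< n) j Pss <<< _).testBit b =
      true at hb
    rw [Nat.testBit_or, Bool.or_eq_true, Nat.testBit_shiftLeft, Bool.and_eq_true,
      decide_eq_true_iff] at hb
    obtain hb | ⟨hG, hb⟩ := hb
    · obtain ⟨k, -, r, -, e⟩ := testBit_groupColumn hb
      omega
    · have h5 := ih _ hb
      have : 5 ∣ 40 <<< n := by rw [Nat.shiftLeft_eq]; exact Dvd.dvd.mul_right (by norm_num) _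
      omega

theorem testBit_column {j : ℕ} {Pss : List (List ℕ)} (hPss : ∀ Ps ∈ Pss, Ps.length ≤ 8)
    {g k r P : ℕ} {Ps : List ℕ} (hk : k < 2 ^ n) (hg : Pss[g]? = some Ps) (hr : Ps[r]? = some P) :
    (column (ones 40 n) (40 <<< n) j Pss).testBit ((40 <<< n) * g + (40 * k + 5 * r)) =
      P.testBit (40 * k + j) := by
  induction Pss generalizing g with
  | nil => simp at hg
  | cons Ps' Pss ih =>
    change (groupColumn (ones 40 n) j Ps' |||
      column (ones 40 n) (40 <<< n) j Pss <<< (40 <<< n)).testBit _ = _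
    rw [Nat.testBit_or, Nat.testBit_shiftLeft]
    have hlen := hPss Ps' (by simp)
    cases g with
    | zero =>
      obtain rfl : Ps' = Ps := by simpa using hg
      obtain ⟨hr', -⟩ := List.getElem?_eq_some_iff.1 hr
      have : ¬ 40 <<< n ≤ 40 <<< n * 0 + (40 * k + 5 * r) := by
        rw [Nat.shiftLeft_eq]; omega
      rw [mul_zero, zero_add] at this ⊢
      rw [testBit_groupColumn_lane hlen hk hr]
      simp [this]
    | succ g =>
      have h1 : (groupColumn (ones 40 n) j Ps').testBit
          (40 <<< n * (g + 1) + (40 * k + 5 * r)) = false := by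
        by_contra h
        rw [Bool.not_eq_false] at h
        obtain ⟨k', hk', r', hr', e⟩ := testBit_groupColumn h
        rw [Nat.shiftLeft_eq, mul_add_one] at e
        omega
      have h2 : 40 <<< n * (g + 1) + (40 * k + 5 * r) - 40 <<< n =
          40 <<< n * g + (40 * k + 5 * r) := by rw [mul_add_one]; omega
      rw [h1, h2, ih (fun Ps hPs => hPss Ps (by simp [hPs])) (by simpa using hg)]
      have : 40 <<< n * (g + 1) + (40 * k + 5 * r) ≥ 40 <<< n := by rw [mul_add_one]; omega
      simp [this]

theorem getD_columns (mask G : ℕ) (Pss : List (List ℕ)) (R j i : ℕ) :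
    (columns mask G Pss R j).getD i 0 = if i < R then column mask G (j + i) Pss else 0 := by
  induction R generalizing i j with
  | zero => rfl
  | succ R ih =>
    change (column mask G j Pss :: columns mask G Pss R (j + 1)).getD i 0 = _
    cases i with
    | zero => simp
    | succ i =>
      rw [List.getD_cons_succ, ih]
      simp only [Nat.succ_lt_succ_iff, add_right_comm j 1 i]
      rfl

end Columns

/-- The `k`-th entry of `Z` consists of the first `R` terms of `σ`. -/
def IsEntry (σ : ℕ → Bool) (R k Z : ℕ) : Prop :=
  ∀ j < 40, Z.testBit (40 * k + j) = (trunc R σ j || decide (j = 39))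

theorem exists_sub_and_pred {M : ℕ} (hM : M ≠ 0) :
    ∃ s, M.testBit s ∧ (∀ i < s, M.testBit i = false) ∧ M - (M &&& (M - 1)) = 2 ^ s := by
  obtain ⟨s, q, hq, rfl⟩ := Nat.exists_eq_two_pow_mul_odd hM
  obtain ⟨q, rfl⟩ := hq
  refine ⟨s, by simp [Nat.testBit_two_pow_mul], fun i hi => by
    simp [Nat.testBit_two_pow_mul, hi.not_ge], ?_⟩
  have e0 : 2 ^ s * (2 * q + 1) = 2 ^ (s + 1) * q + 2 ^ s := by ring
  have hs := Nat.two_pow_pos s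
  have e1 : 2 ^ s * (2 * q + 1) - 1 = 2 ^ (s + 1) * q + (2 ^ s - 1) := by omega
  have hs1 : 2 ^ s < 2 ^ (s + 1) := Nat.pow_lt_pow_right (by norm_num) (by omega)
  have : (2 ^ (s + 1) * q + 2 ^ s) &&& (2 ^ (s + 1) * q + (2 ^ s - 1)) = 2 ^ (s + 1) * q + 0 := by
    apply Nat.eq_of_testBit_eq
    intro i
    rw [Nat.testBit_and, Nat.testBit_two_pow_mul_add _ hs1,
      Nat.testBit_two_pow_mul_add _ (by omega : 2 ^ s - 1 < 2 ^ (s + 1)),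
      Nat.testBit_two_pow_mul_add _ (by positivity)]
    split_ifs with h
    · rw [Nat.testBit_two_pow, Nat.testBit_two_pow_sub_one]
      by_cases h : s = i <;> simp [h]
    · simp
  rw [e1, e0, this]
  omega

theorem IsEntry.shiftRight {σ : ℕ → Bool} {R k a Z : ℕ} (h : IsEntry σ R (k + a) Z) :
    IsEntry σ R k (Z >>> (40 * a)) := by
  intro j hj
  rw [Nat.testBit_shiftRight, ← h j hj]
  congr 1
  ring

theorem IsEntry.marker {σ : ℕ → Bool} {R k Z : ℕ} (h : IsEntry σ R k Z) :
    Z.testBit (40 * k + 39) = true := by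
  rw [h 39 (by norm_num)]; simp

theorem IsEntry.normalize {σ : ℕ → Bool} {n R k Z : ℕ} (h : IsEntry σ R k Z) (hk : k < 2 ^ n) :
    ∃ k' ≤ k, IsEntry σ R k' (normalize (ones 40 n) Z) := by
  set M := Z >>> 39 &&& ones 40 n with hM
  have hMk : M.testBit (40 * k) = true := by
    rw [hM, Nat.testBit_and, Nat.testBit_shiftRight, add_comm, h.marker,
      (testBit_ones 40 n _ (by norm_num)).2 ⟨k, hk, rfl⟩]
    rfl
  obtain ⟨s, hs, hlow, e⟩ := exists_sub_and_pred (M := M) (by rintro h; simp [h] at hMk)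
  have hs' : (ones 40 n).testBit s = true := by
    rw [hM, Nat.testBit_and, Bool.and_eq_true] at hs
    exact hs.2
  obtain ⟨a, ha, rfl⟩ := (testBit_ones 40 n _ (by norm_num)).1 hs'
  have hak : a ≤ k := by
    by_contra hlt
    have := hlow (40 * k) (by omega)
    simp [this] at hMk
  obtain ⟨k', rfl⟩ := Nat.exists_eq_add_of_le' hak
  refine ⟨k', by omega, ?_⟩
  change IsEntry σ R k' (Z / (M - (M &&& (M - 1))))
  rw [e, ← Nat.shiftRight_eq_div_pow]
  exact h.shiftRight

theorem IsEntry.shiftLeft_or {σ : ℕ → Bool} {R k Q : ℕ} (h : IsEntry σ R k Q) (a : ℕ) :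
    IsEntry σ R (k + 1) (Q <<< 40 ||| (a &&& (1 <<< 40 - 1))) := by
  intro j hj
  rw [Nat.testBit_or, Nat.testBit_shiftLeft, Nat.testBit_and, Nat.one_shiftLeft,
    Nat.testBit_two_pow_sub_one, ← h j hj]
  simp [show ¬ 40 * (k + 1) + j < 40 by omega, show 40 ≤ 40 * (k + 1) + j by omega,
    show 40 * (k + 1) + j - 40 = 40 * k + j by omega]

theorem extract_succ (mask base fuel Z Q : ℕ) : extract mask base (fuel + 1) Z Q =
    if Z = 0 then Q else extract mask base fuel (normalize mask (Z >>> 40))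
      (Q <<< 40 ||| ((base ||| Z) &&& (1 <<< 40 - 1))) := by
  cases Z with
  | zero => rfl
  | succ Z =>
    rw [if_neg (Nat.succ_ne_zero Z)]
    change force (force (extract mask base fuel) (normalize mask ((Z + 1) >>> 40)))
      (Q <<< 40 ||| ((base ||| (Z + 1)) &&& (1 <<< 40 - 1))) = _
    rw [force_eq, force_eq]

theorem exists_isEntry_extract {σ : ℕ → Bool} {R Q : ℕ} (mask base fuel Z : ℕ)
    (h : ∃ k, IsEntry σ R k Q) : ∃ k, IsEntry σ R k (extract mask base fuel Z Q) := by
  induction fuel generalizing Z Q with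
  | zero => exact h
  | succ fuel ih =>
    rw [extract_succ]
    split_ifs with hZ
    · exact h
    · obtain ⟨k, hk⟩ := h
      exact ih _ ⟨_, hk.shiftLeft_or _⟩

theorem IsEntry.extract {σ : ℕ → Bool} {n R p k base fuel Z : ℕ} (Q : ℕ) (hR : R ≤ p)
    (hbase : ∀ j, base.testBit j = (decide (R ≤ j) && trunc p σ j))
    (h : IsEntry σ R k Z) (hk : k < 2 ^ n) (hfuel : k < fuel) :
    ∃ k', IsEntry σ p k' (extract (ones 40 n) base fuel Z Q) := by
  induction fuel generalizing k Z Q with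
  | zero => omega
  | succ fuel ih =>
    have hZ : Z ≠ 0 := by rintro rfl; simpa using h.marker
    rw [extract_succ, if_neg hZ]
    cases k with
    | zero =>
      refine exists_isEntry_extract _ _ _ _ ⟨0, fun j hj => ?_⟩
      have := h j hj
      rw [mul_zero, zero_add] at this ⊢
      rw [Nat.testBit_or, Nat.testBit_shiftLeft, Nat.testBit_and, Nat.one_shiftLeft,
        Nat.testBit_two_pow_sub_one, Nat.testBit_or, this, hbase]
      by_cases h1 : j < R
      · simp [hj, hj.not_ge, h1, h1.not_ge, trunc, h1.trans_le hR]
      · simp [hj, hj.not_ge, h1, not_lt.1 h1, trunc]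
    | succ k =>
      obtain ⟨k', hk', h'⟩ := (IsEntry.shiftRight (a := 1) h).normalize (n := n) (by omega)
      exact ih _ h' (by omega) (by omega)

theorem testBit_sparse_mul_sub_one {X : ℕ} (hX : ∀ b, X.testBit b → 40 ∣ b) (i : ℕ) :
    (X * (1 <<< 40 - 1)).testBit i = if i < 40 then
      ((X.testBit 0).toNat * (2 ^ 40 - 1)).testBit i
      else (X / 2 ^ 40 * (1 <<< 40 - 1)).testBit (i - 40) := by
  have hX0 : X % 2 ^ 40 = (X.testBit 0).toNat := by
    apply Nat.eq_of_testBit_eq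
    intro i
    rw [Nat.testBit_mod_two_pow]
    rcases i with _ | i
    · cases X.testBit 0 <;> simp
    · have h1 : (X.testBit 0).toNat.testBit (i + 1) = false :=
        Nat.testBit_eq_false_of_lt ((Bool.toNat_lt _).trans_le
          (Nat.pow_le_pow_right (n := 2) (by norm_num) (by omega : 1 ≤ i + 1)))
      rw [h1, Bool.and_eq_false_iff, decide_eq_false_iff_not]
      by_contra! h
      have := hX _ (by simpa using h.2)
      omega
  have e : X * (1 <<< 40 - 1) = 2 ^ 40 * (X / 2 ^ 40 * (1 <<< 40 - 1)) +
      (X.testBit 0).toNat * (2 ^ 40 - 1) := by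
    rw [← hX0]
    conv_lhs => rw [← Nat.div_add_mod X (2 ^ 40)]
    rw [add_mul, mul_assoc]
    rfl
  rw [e, Nat.testBit_two_pow_mul_add _ (by cases X.testBit 0 <;> norm_num)]

theorem testBit_mul_sub_one {X : ℕ} (hX : ∀ b, X.testBit b → 40 ∣ b) (k : ℕ) {j : ℕ}
    (hj : j < 40) : (X * (1 <<< 40 - 1)).testBit (40 * k + j) = X.testBit (40 * k) := by
  induction k generalizing X with
  | zero =>
    rw [testBit_sparse_mul_sub_one hX, mul_zero, zero_add, if_pos hj]
    cases X.testBit 0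
    · simp
    · simp only [Bool.toNat_true, one_mul]
      rw [Nat.testBit_two_pow_sub_one]
      simpa using hj
  | succ k ih =>
    rw [testBit_sparse_mul_sub_one hX, if_neg (by omega), show 40 * (k + 1) + j - 40 = 40 * k + j by omega, ih,
      Nat.testBit_div_two_pow]
    · rfl
    · intro b hb
      rw [Nat.testBit_div_two_pow] at hb
      have := hX _ hb
      omega

theorem exists_isEntry_gather {σ : ℕ → Bool} {R Q : ℕ} (mask gmask off P : ℕ) (t : BitTree)
    (p base : ℕ) (h : ∃ k, IsEntry σ R k Q) :
    ∃ k, IsEntry σ R k (gather mask gmask off P t p base Q) := by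
  induction t generalizing p base Q with
  | nil => exact h
  | leaf S =>
    change ∃ k, IsEntry σ R k (force (fun Z => extract mask base Z Z Q) _)
    rw [force_eq]
    exact exists_isEntry_extract _ _ _ _ h
  | node l r ihl ihr => exact ihr _ _ (ihl _ _ h)

theorem Mem.exists_isEntry_gather {σ : ℕ → Bool} {n R k r d p base P : ℕ} {t : BitTree} (Q : ℕ)
    (hR : R ≤ p) (hbase : ∀ j, base.testBit j = (decide (R ≤ j) && trunc p σ j))
    (h : IsEntry σ R k P) (hk : k < 2 ^ n) (hr : r < 8) (ht : Mem σ (8 * k + r) d p t) :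
    ∃ k', IsEntry σ (p + d) k'
      (gather (ones 40 n) (1 <<< (40 <<< n) - 1) (5 * r + 4) P t p base Q) := by
  induction t generalizing d p base Q with
  | nil => cases d <;> simp [Mem] at ht
  | leaf S =>
    cases d with
    | succ d => simp [Mem] at ht
    | zero =>
      rw [Mem] at ht
      change ∃ k', IsEntry σ p k' (force (fun Z => Sieve.extract _ base Z Z Q) _)
      rw [force_eq]
      set X := (S &&& (1 <<< (40 <<< n) - 1)) >>> (5 * r + 4) &&& ones 40 n with hXdef
      have hX : ∀ b, X.testBit b → 40 ∣ b := fun b hb => by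
        rw [hXdef, Nat.testBit_and, Bool.and_eq_true] at hb
        obtain ⟨k, -, rfl⟩ := (testBit_ones 40 n _ (by norm_num)).1 hb.2
        exact dvd_mul_right _ _
      have hXk : X.testBit (40 * k) = true := by
        have hlt : 5 * r + 4 + 40 * k < 40 * 2 ^ n := by omega
        rw [hXdef, Nat.testBit_and, (testBit_ones 40 n _ (by norm_num)).2 ⟨k, hk, rfl⟩,
          Nat.testBit_shiftRight, Nat.testBit_and, Nat.one_shiftLeft, Nat.shiftLeft_eq,
          Nat.testBit_two_pow_sub_one, decide_eq_true hlt, Bool.and_true, Bool.and_true, ← ht]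
        congr 1
        ring
      have hZ : IsEntry σ R k (P &&& (X * (1 <<< 40 - 1))) := fun j hj => by
        rw [Nat.testBit_and, testBit_mul_sub_one hX _ hj, hXk, h j hj, Bool.and_true]
      obtain ⟨k', hk', hZ'⟩ := hZ.normalize hk
      refine hZ'.extract Q hR hbase (hk'.trans_lt hk) ?_
      have := Nat.ge_two_pow_of_testBit hZ'.marker
      have h2 : k' < 2 ^ k' := Nat.lt_two_pow_self
      have h3 : 2 ^ k' ≤ 2 ^ (40 * k' + 39) := Nat.pow_le_pow_right (by norm_num) (by omega)
      exact (h2.trans_le h3).trans_le this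
  | node l r' ihl ihr =>
    cases d with
    | zero => simp [Mem] at ht
    | succ d =>
      rw [Mem] at ht
      rw [show p + (d + 1) = p + 1 + d by omega]
      change ∃ k', IsEntry σ (p + 1 + d) k' (gather _ _ _ P r' (p + 1) (base ||| 1 <<< p)
        (gather _ _ _ P l (p + 1) base Q))
      split_ifs at ht with hσ
      · refine ihr _ (by omega) (fun j => ?_) ht
        rw [Nat.testBit_or, hbase, Nat.one_shiftLeft, Nat.testBit_two_pow, trunc, trunc]
        rcases lt_trichotomy j p with hj | rfl | hj
        · simp [hj, hj.ne', hj.trans (Nat.lt_succ_self p)]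
        · simp [hR, hσ]
        · simp [hj.not_gt, hj.ne, show ¬ j < p + 1 by omega]
      · refine Sieve.exists_isEntry_gather _ _ _ _ _ _ _ (ihl _ (by omega) (fun j => ?_) ht)
        rw [hbase, trunc, trunc]
        rcases lt_trichotomy j p with hj | rfl | hj
        · simp [hj, hj.trans (Nat.lt_succ_self p)]
        · simp [hσ]
        · simp [hj.not_gt, show ¬ j < p + 1 by omega]

/-- The first `R` terms of `σ` are one of the candidates. -/
def Has (σ : ℕ → Bool) (R : ℕ) (Pss : List (List ℕ)) : Prop :=
  ∃ (g : ℕ) (Ps : List ℕ) (r P k : ℕ), Pss[g]? = some Ps ∧ Ps[r]? = some P ∧ IsEntry σ R k P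

theorem getElem?_groupRepack {mask gmask R : ℕ} {t : BitTree} {Ps : List ℕ} {r P : ℕ}
    (hr : Ps[r]? = some P) (off : ℕ) : (groupRepack mask gmask R t Ps off)[r]? =
      some (gather mask gmask (5 * r + off) P t R 0 0) := by
  induction Ps generalizing r off with
  | nil => simp at hr
  | cons P' Ps ih =>
    change (gather mask gmask off P' t R 0 0 :: groupRepack mask gmask R t Ps (off + 5))[r]? = _
    cases r with
    | zero =>
      obtain rfl : P' = P := by simpa using hr
      simp
    | succ r =>
      rw [List.getElem?_cons_succ, ih (by simpa using hr)]
      congr 2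
      ring

theorem length_groupRepack (mask gmask R : ℕ) (t : BitTree) (Ps : List ℕ) (off : ℕ) :
    (groupRepack mask gmask R t Ps off).length = Ps.length := by
  induction Ps generalizing off with
  | nil => rfl
  | cons P Ps ih => exact congrArg (· + 1) (ih _)

theorem length_of_mem_repack {mask G gmask R : ℕ} {Pss : List (List ℕ)} {t : BitTree}
    (h : ∀ Ps ∈ Pss, Ps.length ≤ 8) : ∀ Ps ∈ repack mask G gmask R Pss t, Ps.length ≤ 8 := by
  induction Pss generalizing t with
  | nil => simp [repack]
  | cons Ps Pss ih =>
    change ∀ Qs ∈ groupRepack mask gmask R t Ps 4 :: repack mask G gmask R Pss (t.shift G), _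
    intro Qs hQs
    rcases List.mem_cons.1 hQs with rfl | hQs
    · rw [length_groupRepack]; exact h Ps (by simp)
    · exact ih (fun Ps hPs => h Ps (by simp [hPs])) Qs hQs

theorem Mem.has_repack {σ : ℕ → Bool} {n R k r g d P : ℕ} {Ps : List ℕ} {Pss : List (List ℕ)}
    {t : BitTree} (hPss : ∀ Ps ∈ Pss, Ps.length ≤ 8) (hg : Pss[g]? = some Ps)
    (hr : Ps[r]? = some P) (h : IsEntry σ R k P) (hk : k < 2 ^ n)
    (ht : Mem σ (8 <<< n * g + (8 * k + r)) d R t) :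
    Has σ (R + d) (repack (ones 40 n) (40 <<< n) (1 <<< (40 <<< n) - 1) R Pss t) := by
  induction Pss generalizing g t with
  | nil => simp at hg
  | cons Ps' Pss ih =>
    change Has σ (R + d) (groupRepack _ _ R t Ps' 4 :: repack _ _ _ R Pss (t.shift (40 <<< n)))
    cases g with
    | zero =>
      obtain rfl : Ps' = Ps := by simpa using hg
      have hr' := (List.getElem?_eq_some_iff.1 hr).1
      have := hPss Ps' (by simp)
      rw [mul_zero, zero_add] at ht
      obtain ⟨k', hk'⟩ := ht.exists_isEntry_gather 0 (base := 0) le_rfl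
        (fun j => by by_cases hj : R ≤ j <;> simp [hj, trunc]) h hk (by omega)
      exact ⟨0, _, r, _, k', rfl, getElem?_groupRepack hr 4, hk'⟩
    | succ g =>
      have e : 40 <<< n = 5 * 8 <<< n := by rw [Nat.shiftLeft_eq, Nat.shiftLeft_eq]; ring
      have e' : 8 <<< n * (g + 1) + (8 * k + r) = 8 <<< n * g + (8 * k + r) + 8 <<< n := by ring
      rw [e'] at ht
      have hs := ht.shift
      rw [← e] at hs
      obtain ⟨g', Qs, r', Q, k', h1, h2, h3⟩ :=
        ih (fun Ps hPs => hPss Ps (by simp [hPs])) (by simpa using hg) hs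
      exact ⟨g' + 1, Qs, r', Q, k', h1, h2, h3⟩

theorem testBit_union {Pss : List (List ℕ)} {g r P b : ℕ} {Ps : List ℕ} (hg : Pss[g]? = some Ps)
    (hr : Ps[r]? = some P) (hb : P.testBit b = true) : (union Pss).testBit b = true := by
  induction Pss generalizing g with
  | nil => simp at hg
  | cons Ps' Pss ih =>
    have key : ∀ Qs : List ℕ, (List.rec (motive := fun _ => ℕ) (union Pss)
        (fun P _ ih => P ||| ih) Qs : ℕ).testBit b = true ↔
        (∃ Q ∈ Qs, Q.testBit b = true) ∨ (union Pss).testBit b = true := by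
      intro Qs
      induction Qs with
      | nil => simp
      | cons Q Qs ihQ => simp only [Nat.testBit_or, Bool.or_eq_true, ihQ]; simp [or_assoc]
    refine (key Ps').2 ?_
    cases g with
    | zero =>
      obtain rfl : Ps' = Ps := by simpa using hg
      exact Or.inl ⟨P, List.mem_of_getElem? hr, hb⟩
    | succ g => exact Or.inr (ih (by simpa using hg))

theorem Has.union_ne_zero {σ : ℕ → Bool} {R : ℕ} {Pss : List (List ℕ)} (h : Has σ R Pss) :
    union Pss ≠ 0 := by
  obtain ⟨g, Ps, r, P, k, hg, hr, hP⟩ := h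
  intro h0
  simpa [h0] using testBit_union hg hr hP.marker

theorem Has.stage {σ : ℕ → Bool} {n R L M : ℕ} {Pss wss : List (List ℕ)}
    {κ : ℕ → List (List ℕ) → Bool} (hPss : ∀ Ps ∈ Pss, Ps.length ≤ 8) (h : Has σ R Pss)
    (hL : L + wss.length ≤ R) (hM : M ≤ 20) (hR : R + 1 = L + M) (hR39 : R ≤ 39)
    (hwss : Accepts σ M L wss) (hs : stage n R Pss wss κ L = true) :
    ∃ Qss : List (List ℕ), (∀ Ps ∈ Qss, Ps.length ≤ 8) ∧ Has σ (R + wss.length) Qss ∧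
      κ (L + wss.length) Qss = true := by
  obtain ⟨g, Ps, r, P, k, hg, hr, hP⟩ := h
  set full := column (ones 40 n) (40 <<< n) 39 Pss with hfull
  change Bool.rec (motive := fun _ => Bool) false (search full
    (columns (ones 40 n) (40 <<< n) Pss R 0) R wss (fun L t => κ L (repack (ones 40 n) (40 <<< n)
      (1 <<< (40 <<< n) - 1) R Pss t)) L (.leaf (full <<< 4)))
    (Nat.beq (union Pss >>> (40 <<< n)) 0) = true at hs
  cases hu : Nat.beq (union Pss >>> (40 <<< n)) 0
  · simp [hu] at hs
  rw [hu] at hs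
  have hk : k < 2 ^ n := by
    by_contra hk
    have h1 := testBit_union hg hr hP.marker
    have h2 : (union Pss >>> (40 <<< n)).testBit (40 * k + 39 - 40 <<< n) = true := by
      rw [Nat.testBit_shiftRight, ← h1]
      congr 1
      rw [Nat.shiftLeft_eq]
      omega
    rw [Nat.eq_of_beq_eq_true hu] at h2
    simp at h2
  have hlane : 5 * (8 <<< n * g + (8 * k + r)) = 40 <<< n * g + (40 * k + 5 * r) := by
    rw [Nat.shiftLeft_eq, Nat.shiftLeft_eq]; ring
  obtain ⟨t, ht, hκ⟩ := mem_search (v := 8 <<< n * g + (8 * k + r)) (d := 0) (M := M)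
    (flags_column 39 Pss) (by rw [hlane, testBit_column hPss hk hg hr, hP.marker])
    (fun i => by
      rw [getD_columns]
      split_ifs
      · exact flags_column _ _
      · exact Flags.zero)
    (fun p => by
      rw [getD_columns]
      split_ifs with hp
      · rw [hlane, testBit_column hPss hk hg hr, zero_add, hP p (by omega)]
        simp [show p ≠ 39 by omega]
      · simp [trunc, hp])
    hL hM (by omega) hwss (by
      rw [Mem, Nat.testBit_shiftLeft, Nat.add_sub_cancel, hlane, testBit_column hPss hk hg hr,
        hP.marker]
      simp) hs
  rw [zero_add] at ht
  exact ⟨_, length_of_mem_repack hPss, ht.has_repack hPss hg hr hP hk, hκ⟩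

theorem accepts_append {σ : ℕ → Bool} {M L : ℕ} {wss wss' : List (List ℕ)} :
    Accepts σ M L (wss ++ wss') ↔ Accepts σ M L wss ∧ Accepts σ M (L + wss.length) wss' := by
  induction wss generalizing L with
  | nil => simp [Accepts]
  | cons ws wss ih =>
    simp only [List.cons_append, Accepts, ih, List.length_cons, and_assoc]
    rw [add_assoc, add_comm 1]

theorem not_accepts_of_stages {σ : ℕ → Bool} {R L M : ℕ} {Pss : List (List ℕ)}
    {wsss : List (List (List ℕ))} (hPss : ∀ Ps ∈ Pss, Ps.length ≤ 8) (h : Has σ R Pss)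
    (hL : L + wsss.flatten.length < M) (hM : M ≤ 20) (hR : R + 1 = L + M)
    (hs : stages wsss R Pss L = true) : ¬ Accepts σ M L wsss.flatten := by
  induction wsss generalizing R L Pss with
  | nil => exact absurd hs Bool.false_ne_true
  | cons wss wsss ih =>
    rw [List.flatten_cons, accepts_append]
    rw [List.flatten_cons, List.length_append] at hL
    rintro ⟨h1, h2⟩
    change Sieve.stage (depth (union Pss)) R Pss wss (fun L Pss => Nat.rec (motive := fun _ => Bool)
      true (fun _ _ => stages wsss (R + wss.length) Pss L) (union Pss)) L = true at hs
    obtain ⟨Qss, hQss, hQ, hκ⟩ := h.stage hPss (by omega) hM hR (by omega) h1 hs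
    refine ih hQss hQ (by omega) (by omega) ?_ h2
    obtain ⟨s, hs⟩ := Nat.exists_eq_succ_of_ne_zero hQ.union_ne_zero
    rwa [hs] at hκ

theorem testBit_sum_pow_mul {a : ℕ → ℕ} {N k j : ℕ} (ha : ∀ k < N, a k < 2 ^ 40)
    (hk : k < N) (hj : j < 40) :
    (∑ i ∈ Finset.range N, a i * 2 ^ (40 * i)).testBit (40 * k + j) = (a k).testBit j := by
  induction N generalizing a k with
  | zero => omega
  | succ N ih =>
    have e : ∑ i ∈ Finset.range (N + 1), a i * 2 ^ (40 * i) =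
        2 ^ 40 * (∑ i ∈ Finset.range N, a (i + 1) * 2 ^ (40 * i)) + a 0 := by
      rw [Finset.sum_range_succ', Finset.mul_sum]
      simp only [mul_add_one, pow_add]
      congr 1
      · exact Finset.sum_congr rfl fun i _ => by ring
      · simp
    rw [e, Nat.testBit_two_pow_mul_add _ (ha 0 (by omega))]
    cases k with
    | zero => simp [hj]
    | succ k =>
      rw [if_neg (by omega), show 40 * (k + 1) + j - 40 = 40 * k + j by omega,
        ih (fun k hk => ha (k + 1) (by omega)) (by omega)]

theorem ones_eq_sum (n : ℕ) : ones 40 n = ∑ i ∈ Finset.range (2 ^ n), 2 ^ (40 * i) := by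
  induction n with
  | zero => rfl
  | succ n ih =>
    change ones 40 n + ones 40 n <<< (40 <<< n) = _
    rw [pow_succ, mul_two, Finset.sum_range_add, ← ih, Nat.shiftLeft_eq, Nat.shiftLeft_eq]
    conv_lhs => rw [ih]
    simp only [mul_add, pow_add, ← Finset.mul_sum]
    rw [ih, mul_comm (2 ^ _)]

theorem packed_eq_sum (b n base : ℕ) : packed b n base =
    ∑ i ∈ Finset.range (2 ^ n), (base + i * 2 ^ b + 2 ^ 39) * 2 ^ (40 * i) := by
  have key : (Nat.rec (motive := fun _ => ℕ) 0 (fun i x => x + (x + ones 40 i <<< i) <<< (40 <<< i))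
      n : ℕ) = ∑ i ∈ Finset.range (2 ^ n), i * 2 ^ (40 * i) := by
    induction n with
    | zero => rfl
    | succ n ih =>
      simp only [ih]
      rw [pow_succ, mul_two, Finset.sum_range_add, ones_eq_sum]
      simp only [Nat.shiftLeft_eq, mul_add, pow_add, add_mul, Finset.sum_add_distrib,
        ← Finset.mul_sum]
      congr 1
      simp only [mul_left_comm _ (2 ^ (40 * 2 ^ n)), ← Finset.mul_sum]
      ring
  change ones 40 n * (base + 1 <<< 39) + (Nat.rec (motive := fun _ => ℕ) 0
    (fun i x => x + (x + ones 40 i <<< i) <<< (40 <<< i)) n : ℕ) <<< b = _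
  rw [key, ones_eq_sum, Nat.shiftLeft_eq, Nat.shiftLeft_eq, Finset.sum_mul, Finset.sum_mul,
    ← Finset.sum_add_distrib]
  exact Finset.sum_congr rfl fun i _ => by ring

theorem has_initial {σ : ℕ → Bool} {b p : ℕ} (hb : b ≤ 20) (hp : p < 2 ^ b)
    (hσ : ∀ j < b, p.testBit j = σ j) : Has σ (b + 15) (initial b p) := by
  set N := Nat.ofBits (fun i : Fin (b + 15) => σ i) with hN
  have hNlt : N < 2 ^ (b + 15) := Nat.ofBits_lt_two_pow _
  have hNbit : ∀ j, N.testBit j = trunc (b + 15) σ j := fun j => by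
    by_cases hj : j < b + 15
    · rw [hN, Nat.testBit_ofBits_lt _ _ hj]; simp [trunc, hj]
    · rw [hN, Nat.testBit_ofBits_ge _ _ (by omega)]; simp [trunc, hj]
  have hNp : N % 2 ^ b = p := by
    apply Nat.eq_of_testBit_eq
    intro i
    rw [Nat.testBit_mod_two_pow, hNbit]
    by_cases hi : i < b
    · simp [hi, hσ i hi, trunc, show i < b + 15 by omega]
    · rw [Nat.testBit_eq_false_of_lt (hp.trans_le (Nat.pow_le_pow_right (by norm_num)
        (not_lt.1 hi)))]
      simp [hi]
  set a := N / 2 ^ b with ha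
  have ha15 : a < 2 ^ 15 := by
    rw [ha]
    apply Nat.div_lt_of_lt_mul
    rwa [← pow_add]
  have ht : a % 64 / 8 < 8 := by omega
  have hs : a % 8 < 8 := by omega
  have hbase : ∀ u, u <<< b = u * 2 ^ b := fun u => Nat.shiftLeft_eq _ _
  have h6 : 2 ^ (b + 6) = 2 ^ b * 64 := pow_add _ _ _
  have hb20 : 2 ^ b ≤ 2 ^ 20 := Nat.pow_le_pow_right (by norm_num) hb
  refine ⟨a % 64 / 8, (List.range 8).map fun s =>
    packed (b + 6) 9 (p + (8 * (a % 64 / 8) + s) <<< b), a % 8, packed (b + 6) 9 (p + (8 * (a % 64 / 8) + a % 8) <<< b), a / 64,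
    ?_, ?_, fun j hj => ?_⟩
  · unfold initial
    rw [List.getElem?_map, List.getElem?_range ht]
    rfl
  · rw [List.getElem?_map, List.getElem?_range hs]
    rfl
  · have hNeq : p + (8 * (a % 64 / 8) + a % 8) * 2 ^ b + a / 64 * 2 ^ (b + 6) = N := by
      have h1 : N = p + 2 ^ b * a := by rw [← hNp, ha, Nat.mod_add_div]
      have h2 : a = 8 * (a % 64 / 8) + a % 8 + a / 64 * 64 := by omega
      rw [h1, h6]
      conv_rhs => rw [h2]
      ring
    have hsmall : p + (8 * (a % 64 / 8) + a % 8) * 2 ^ b < 2 ^ b * 64 := by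
      have : 8 * (a % 64 / 8) + a % 8 + 1 ≤ 64 := by omega
      have := Nat.mul_le_mul_right (2 ^ b) this
      rw [add_mul, one_mul] at this
      omega
    rw [packed_eq_sum, hbase]
    have hfin : ∀ k, k < 2 ^ 9 → p + (8 * (a % 64 / 8) + a % 8) * 2 ^ b + k * 2 ^ (b + 6) +
        2 ^ 39 < 2 ^ 40 := fun k hk => by
      have : (k + 1) * 2 ^ (b + 6) ≤ 2 ^ 9 * 2 ^ (b + 6) := Nat.mul_le_mul_right _ hk
      rw [h6, add_mul] at this
      rw [h6]
      omega
    rw [testBit_sum_pow_mul hfin (by omega) hj, hNeq, add_comm, ← hNbit]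
    have h39 : N < 2 ^ 39 := hNlt.trans_le (Nat.pow_le_pow_right (by norm_num) (by omega))
    by_cases hj39 : j = 39
    · subst hj39
      rw [Nat.testBit_two_pow_add_eq, Nat.testBit_eq_false_of_lt h39]
      rfl
    · rw [Nat.testBit_two_pow_add_gt (by omega)]
      simp [hj39]

theorem not_accepts {σ : ℕ → Bool} {b p : ℕ} {wsss : List (List (List ℕ))} (hb : b ≤ 4)
    (hp : p < 2 ^ b) (hσ : ∀ j < b, p.testBit j = σ j)
    (hlen : wsss.flatten.length < b + 16) (hs : stages wsss (b + 15) (initial b p) 0 = true) :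
    ¬ Accepts σ (b + 16) 0 wsss.flatten :=
  not_accepts_of_stages (by
    intro Ps hPs
    obtain ⟨t, -, rfl⟩ := List.mem_map.1 hPs
    simp) (has_initial (by omega) hp hσ) (by omega) (by omega) (by omega) hs

/-! ### Toeplitz matrices as binary sequences -/

/-- The Toeplitz matrix whose diagonals, from the lower left corner on, are given by `τ`. -/
def toeplitz (m : ℕ) (τ : ℕ → Bool) : Matrix (Fin m) (Fin m) (ZMod 2) :=
  fun i j => if τ (i.rev + j) then 1 else 0

/-- The vector with the bits of `y`, the last coordinate being the lowest bit. -/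
def word (m y : ℕ) (i : Fin m) : ZMod 2 := if y.testBit i.rev then 1 else 0

theorem isToeplitz_toeplitz (m : ℕ) (τ : ℕ → Bool) : IsToeplitz (toeplitz m τ) := by
  intro i j i' j' h
  have : (i.rev + j : ℕ) = i'.rev + j' := by rw [Fin.val_rev, Fin.val_rev]; omega
  rw [toeplitz, toeplitz, this]

theorem exists_eq_toeplitz {m : ℕ} {A : Matrix (Fin m) (Fin m) (ZMod 2)} (hA : IsToeplitz A) :
    ∃ τ, A = toeplitz m τ := by
  classical
  refine ⟨fun p => decide (∃ i j : Fin m, (i.rev + j : ℕ) = p ∧ A i j ≠ 0), ?_⟩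
  ext i j
  rw [toeplitz]
  split_ifs with h
  · obtain ⟨i', j', e, h'⟩ := of_decide_eq_true h
    rw [Fin.val_rev, Fin.val_rev] at e
    rw [hA i j i' j' (by omega)]
    generalize A i' j' = a at h'
    decide +revert
  · by_contra h0
    exact h (decide_eq_true ⟨i, j, rfl, h0⟩)

theorem exists_eq_word {m : ℕ} (u : Fin m → ZMod 2) : ∃ y < 2 ^ m, u = word m y := by
  refine ⟨Nat.ofBits fun i : Fin m => decide (u i.rev ≠ 0), Nat.ofBits_lt_two_pow _, ?_⟩
  ext i
  rw [word, Nat.testBit_ofBits_lt _ _ i.rev.isLt]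
  simp only [Fin.eta, Fin.rev_rev]
  generalize u i = a
  decide +revert

theorem ite_conv (n x : ℕ) (σ : ℕ → Bool) (j : ℕ) :
    (if conv n x σ j then 1 else 0 : ZMod 2) = ∑ i ∈ Finset.range n,
      (if x.testBit i then 1 else 0) * (if σ (i + j) then 1 else 0) := by
  induction n generalizing x j with
  | zero => rfl
  | succ n ih =>
    rw [Finset.sum_range_succ', conv]
    have : ∑ i ∈ Finset.range n, (if x.testBit (i + 1) then 1 else 0 : ZMod 2) *
        (if σ (i + 1 + j) then 1 else 0) = if conv n (x >>> 1) σ (j + 1) then 1 else 0 := by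
      rw [ih]
      refine Finset.sum_congr rfl fun i _ => ?_
      rw [Nat.testBit_shiftRight, add_comm 1 i, add_assoc, add_comm 1 j]
    rw [this, zero_add]
    cases conv n (x >>> 1) σ (j + 1) <;> cases x.testBit 0 <;> cases σ j <;> decide

theorem vecMul_toeplitz (m y : ℕ) (τ : ℕ → Bool) (j : Fin m) :
    vecMul (word m y) (toeplitz m τ) j = if conv m y τ j then 1 else 0 := by
  rw [ite_conv, ← Fin.sum_univ_eq_sum_range
    (fun i => (if y.testBit i then 1 else 0 : ZMod 2) * (if τ (i + j) then 1 else 0)),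
    ← Equiv.sum_comp Fin.revPerm]
  rfl

theorem bitCount_eq_count (n x : ℕ) : bitCount n x = Nat.count (fun i => x.testBit i = true) n := by
  induction n generalizing x with
  | zero => rfl
  | succ n ih =>
    change (x &&& 1) + bitCount n (x >>> 1) = _
    rw [ih, Nat.count_succ', add_comm]
    congr 1
    · simp only [Nat.testBit_shiftRight, add_comm 1]
    · rw [Nat.and_one_is_mod, Nat.testBit_zero]
      rcases Nat.mod_two_eq_zero_or_one x with h | h <;> simp [h]

theorem wt_ite {m : ℕ} (p : ℕ → Bool) :
    wt (fun i : Fin m => if p i then 1 else 0 : Fin m → ZMod 2) =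
      Nat.count (fun i => p i = true) m := by
  rw [wt, Nat.card_eq_fintype_card, Fintype.card_subtype, Nat.count_eq_card_filter_range,
    Finset.card_filter, Finset.card_filter, ← Fin.sum_univ_eq_sum_range
    (fun i => if p i = true then 1 else 0)]
  refine Finset.sum_congr rfl fun i _ => ?_
  cases p i <;> simp

theorem wt_comp_rev {m : ℕ} (u : Fin m → ZMod 2) : wt (fun i : Fin m => u i.rev) = wt u :=
  Nat.card_congr (Fin.revPerm.subtypeEquiv fun _ => Iff.rfl)

theorem wt_elim {m : ℕ} (u w : Fin m → ZMod 2) : wt (Sum.elim u w) = wt u + wt w := by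
  rw [wt, wt, wt, ← Nat.card_sum]
  exact Nat.card_congr (Equiv.subtypeSum.trans (Equiv.refl _))

theorem wt_word (m y : ℕ) : wt (word m y) = bitCount m y := by
  rw [bitCount_eq_count, ← wt_ite, ← wt_comp_rev]
  congr 1
  ext i
  rw [word, Fin.rev_rev]

theorem wt_codeword (m y : ℕ) (τ : ℕ → Bool) :
    wt (Sum.elim (word m y) (vecMul (word m y) (toeplitz m τ))) =
      bitCount m y + Nat.count (fun j => conv m y τ j = true) m := by
  rw [wt_elim, wt_word, ← wt_ite]
  congr 2
  ext j
  exact vecMul_toeplitz m y τ j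

theorem word_ne_zero {m y : ℕ} (h0 : y ≠ 0) (hy : y < 2 ^ m) : word m y ≠ 0 := by
  intro h
  obtain ⟨i, hi⟩ := Nat.exists_testBit_of_ne_zero h0
  have him : i < m := by
    by_contra him
    rw [Nat.testBit_eq_false_of_lt (hy.trans_le (Nat.pow_le_pow_right two_pos (not_lt.1 him)))] at hi
    exact Bool.false_ne_true hi
  have := congrFun h (Fin.rev ⟨i, him⟩)
  rw [word, Fin.rev_rev] at this
  simp [hi] at this

theorem exists_code_iff (m : ℕ) :
    (∃ A : Matrix (Fin m) (Fin m) (ZMod 2), IsToeplitz A ∧ ∀ c ∈ DTcode A, c ≠ 0 → 10 ≤ wt c) ↔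
      ∃ τ : ℕ → Bool, ∀ y, y ≠ 0 → y < 2 ^ m →
        10 ≤ bitCount m y + Nat.count (fun j => conv m y τ j = true) m := by
  constructor
  · rintro ⟨A, hA, h⟩
    obtain ⟨τ, rfl⟩ := exists_eq_toeplitz hA
    refine ⟨τ, fun y h0 hy => ?_⟩
    rw [← wt_codeword]
    refine h _ ⟨word m y, rfl⟩ fun hc => word_ne_zero h0 hy ?_
    ext i
    exact congrFun hc (Sum.inl i)
  · rintro ⟨τ, h⟩
    refine ⟨toeplitz m τ, isToeplitz_toeplitz m τ, ?_⟩
    rintro c ⟨u, rfl⟩ hc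
    obtain ⟨y, hy, rfl⟩ := exists_eq_word u
    rw [wt_codeword]
    refine h y ?_ hy
    rintro rfl
    apply hc
    have : word m 0 = 0 := by ext i; simp [word]
    rw [this, zero_vecMul]
    ext (i | i) <;> rfl

theorem conv_zero (n : ℕ) (σ : ℕ → Bool) (j : ℕ) : conv n 0 σ j = false := by
  induction n generalizing j with
  | zero => rfl
  | succ n ih => simp [conv, ih]

theorem conv_shiftLeft (n x : ℕ) (σ : ℕ → Bool) (a j : ℕ) :
    conv (n + a) (x <<< a) σ j = conv n x σ (j + a) := by
  induction a generalizing j with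
  | zero => rfl
  | succ a ih =>
    rw [← add_assoc, conv, Nat.shiftLeft_add, Nat.shiftLeft_shiftRight, ih, add_assoc, add_comm 1]
    simp

theorem conv_of_lt {n m x : ℕ} (hx : x < 2 ^ n) (h : n ≤ m) (σ : ℕ → Bool) (j : ℕ) :
    conv m x σ j = conv n x σ j := by
  induction n generalizing m x j with
  | zero =>
    obtain rfl : x = 0 := by simpa using hx
    exact conv_zero m σ j
  | succ n ih =>
    obtain ⟨m, rfl⟩ := Nat.exists_eq_add_of_le' (Nat.one_le_of_lt h)
    rw [conv, conv, ih (by rw [Nat.shiftRight_eq_div_pow]; omega) (by omega)]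

theorem bitCount_shiftLeft (n x a : ℕ) : bitCount (n + a) (x <<< a) = bitCount n x := by
  rw [bitCount_eq_count, bitCount_eq_count, add_comm n a, Nat.count_add]
  have : Nat.count (fun i => (x <<< a).testBit i = true) a = 0 := by
    rw [Nat.count_iff_forall_not]
    intro i hi
    simp [hi.not_ge]
  rw [this]
  simp

theorem bitCount_of_lt {n m x : ℕ} (hx : x < 2 ^ n) (h : n ≤ m) : bitCount m x = bitCount n x := by
  obtain ⟨k, rfl⟩ := Nat.exists_eq_add_of_le h
  rw [bitCount_eq_count, bitCount_eq_count, Nat.count_add, Nat.add_eq_left,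
    Nat.count_iff_forall_not]
  intro i _
  rw [Nat.testBit_eq_false_of_lt (hx.trans_le (Nat.pow_le_pow_right two_pos (by omega)))]
  exact Bool.false_ne_true

/-- Whether the lists consist of words of weight at most 5, the first one of words of degree `L`,
the second one of words of degree `L + 1`, and so on. -/
noncomputable def Valid : ℕ → List (List ℕ) → Bool
  | _, [] => true
  | L, ws :: wss => (ws.all fun x => decide (2 ^ L ≤ x ∧ x < 2 ^ (L + 1) ∧ bitCount (L + 1) x ≤ 5)) &&
      Valid (L + 1) wss

theorem accepts_of_valid {τ : ℕ → Bool} {m M a L : ℕ} {wss : List (List ℕ)}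
    (hτ : ∀ y, y ≠ 0 → y < 2 ^ m → 10 ≤ bitCount m y + Nat.count (fun j => conv m y τ j = true) m)
    (hmM : m ≤ M) (hm : L + wss.length + a ≤ m) (hwss : Valid L wss = true) :
    Accepts (fun p => τ (p + a)) M L wss := by
  induction wss generalizing L with
  | nil => trivial
  | cons ws wss ih =>
    rw [Valid, Bool.and_eq_true, List.all_eq_true] at hwss
    rw [List.length_cons] at hm
    refine ⟨fun x hx => ?_, ih (by omega) hwss.2⟩
    obtain ⟨h1, h2, h3⟩ := of_decide_eq_true (hwss.1 x hx)
    refine ⟨Nat.testBit_of_two_pow_le_and_two_pow_add_one_gt h1 h2, h3, ?_⟩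
    have hlt : x <<< a < 2 ^ (L + 1 + a) := by
      rw [Nat.shiftLeft_eq, pow_add]
      exact Nat.mul_lt_mul_of_pos_right h2 (by positivity)
    have h0 : x <<< a ≠ 0 := by
      have := Nat.two_pow_pos L
      simp
      omega
    have := hτ (x <<< a) h0 (hlt.trans_le (Nat.pow_le_pow_right two_pos (by omega)))
    simp only [conv_of_lt hlt (by omega : L + 1 + a ≤ m), conv_shiftLeft,
      bitCount_of_lt hlt (by omega : L + 1 + a ≤ m), bitCount_shiftLeft] at this
    rw [Good]
    simp only [conv_add]
    exact this.trans (Nat.add_le_add_left (Nat.count_monotone _ hmM) _)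

set_option maxRecDepth 100000

theorem stages_short : stages [shortWords] 15 (initial 0 0) 0 = true := by decide +kernel

theorem stages_0001 :
    stages (rootWords :: laterWords.map fun ws => [ws]) 19 (initial 4 1) 0 = true := by
  decide +kernel

theorem stages_0101 :
    stages (rootWords :: laterWords.map fun ws => [ws]) 19 (initial 4 5) 0 = true := by
  decide +kernel

theorem stages_1001 :
    stages (rootWords :: laterWords.map fun ws => [ws]) 19 (initial 4 9) 0 = true := by
  decide +kernel

theorem stages_1101 :
    stages (rootWords :: laterWords.map fun ws => [ws]) 19 (initial 4 13) 0 = true := by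
  decide +kernel

theorem stages_0000 :
    stages (rootWords :: laterWords.map fun ws => [ws]) 19 (initial 4 0) 0 = true := by
  decide +kernel

theorem stages_1111 :
    stages (rootWords :: laterWords.map fun ws => [ws]) 19 (initial 4 15) 0 = true := by
  decide +kernel

theorem stages_1100 :
    stages (rootWords :: laterWords.map fun ws => [ws]) 19 (initial 4 12) 0 = true := by
  decide +kernel

theorem stages_0100 :
    stages (rootWords :: laterWords.map fun ws => [ws]) 19 (initial 4 4) 0 = true := by
  decide +kernel

theorem stages_1110 :
    stages (rootWords :: laterWords.map fun ws => [ws]) 19 (initial 4 14) 0 = true := by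
  decide +kernel

theorem exists_window (τ : ℕ → Bool) : ∃ a ≤ 2, ∃ p ∈ [1, 5, 9, 13, 0, 15, 12, 4, 14],
    ∀ j < 4, p.testBit j = τ (j + a) := by
  have key : ∀ f : Fin 6 → Bool, ∃ a ≤ 2, ∃ p ∈ [1, 5, 9, 13, 0, 15, 12, 4, 14],
      ∀ j < 4, p.testBit j = f (Fin.ofNat 6 (j + a)) := by decide
  obtain ⟨a, ha, p, hp, h⟩ := key fun i => τ i
  refine ⟨a, ha, p, hp, fun j hj => ?_⟩
  rw [h j hj]
  exact congrArg τ (Nat.mod_eq_of_lt (by omega))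

theorem stages_of_mem {p : ℕ} (hp : p ∈ [1, 5, 9, 13, 0, 15, 12, 4, 14]) :
    stages (rootWords :: laterWords.map fun ws => [ws]) 19 (initial 4 p) 0 = true := by
  fin_cases hp
  exacts [stages_0001, stages_0101, stages_1001, stages_1101, stages_0000, stages_1111,
    stages_1100, stages_0100, stages_1110]

theorem valid_words :
    Valid 0 (rootWords :: laterWords.map fun ws => [ws]).flatten = true := by decide +kernel

theorem valid_shortWords : Valid 0 [shortWords].flatten = true := by decide +kernel

theorem lt_of_forall_le_weight {m : ℕ} (hm : 1 ≤ m) {τ : ℕ → Bool}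
    (hτ : ∀ y, y ≠ 0 → y < 2 ^ m →
      10 ≤ bitCount m y + Nat.count (fun j => conv m y τ j = true) m) : 20 < m := by
  by_contra! h20
  have h9 : 9 ≤ m := by
    have h1 := hτ 1 one_ne_zero (Nat.one_lt_two_pow (by omega))
    have h2 := Nat.count_le (p := fun j => conv m 1 τ j = true) (n := m)
    have h3 : bitCount m 1 = bitCount 1 1 := bitCount_of_lt (by norm_num) hm
    have h4 : bitCount 1 1 = 1 := rfl
    omega
  rcases le_or_gt m 16 with h16 | h16
  · refine not_accepts (b := 0) (p := 0) (by omega) (by norm_num) (by omega) (by decide)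
      stages_short (accepts_of_valid (a := 0) hτ h16 ?_ valid_shortWords)
    have : [shortWords].flatten.length = 6 := rfl
    omega
  · obtain ⟨a, ha, p, hp, h⟩ := exists_window τ
    have hlen : (rootWords :: laterWords.map fun ws => [ws]).flatten.length = 15 := rfl
    refine not_accepts (b := 4) (p := p) le_rfl ?_ h (by omega) (stages_of_mem hp)
      (accepts_of_valid (a := a) hτ h20 (by omega) valid_words)
    have : ∀ p ∈ [1, 5, 9, 13, 0, 15, 12, 4, 14], p < 2 ^ 4 := by decide
    exact this p hp

/-! ### Large dimensions -/

theorem choose_add_two_le {n i : ℕ} (hn : 76 ≤ n) (hi : i ≤ 9) :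
    (n + 2).choose i ≤ 2 * n.choose i := by
  have key : ∀ k, 76 ≤ k → 5 * (k + 1).choose i ≤ 7 * k.choose i := fun k hk => by
    have h := Nat.choose_mul_succ_eq k i
    obtain ⟨d, hd⟩ : ∃ d, k + 1 - i = d := ⟨_, rfl⟩
    rw [hd] at h
    have h1 : 5 * (k + 1) ≤ 7 * d := by omega
    refine Nat.le_of_mul_le_mul_right (c := d) ?_ (by omega)
    calc 5 * (k + 1).choose i * d = k.choose i * (5 * (k + 1)) := by
          rw [mul_assoc, ← h]; ring
      _ ≤ k.choose i * (7 * d) := Nat.mul_le_mul_left _ h1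
      _ = 7 * k.choose i * d := by ring
  have h1 := key n hn
  have h2 := key (n + 1) (by omega)
  rw [show n + 1 + 1 = n + 2 from rfl] at h2
  omega

theorem sum_choose_lt {m : ℕ} (hm : 38 ≤ m) :
    ∑ i ∈ Finset.range 10, (2 * m).choose i < 2 ^ m := by
  induction m, hm using Nat.le_induction with
  | base => decide +kernel
  | succ m hm ih =>
    have h76 : 76 ≤ 2 * m := by omega
    calc ∑ i ∈ Finset.range 10, (2 * (m + 1)).choose i
        ≤ ∑ i ∈ Finset.range 10, 2 * (2 * m).choose i :=
          Finset.sum_le_sum fun i hi => choose_add_two_le h76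
            (Nat.le_of_lt_succ (Finset.mem_range.1 hi))
      _ = 2 * ∑ i ∈ Finset.range 10, (2 * m).choose i := (Finset.mul_sum ..).symm
      _ < 2 ^ (m + 1) := by rw [pow_succ']; omega

theorem eq_of_conv_eq {m y L : ℕ} {σ τ : ℕ → Bool} (hL : L < m) (hy : y < 2 ^ (L + 1))
    (hyL : y.testBit L) (h0 : ∀ p, p < L → σ p = τ p)
    (h1 : ∀ p, L + m ≤ p → p < 2 * m → σ p = τ p)
    (hconv : ∀ j < m, conv m y σ j = conv m y τ j) : ∀ p < 2 * m, σ p = τ p := by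
  intro p
  induction p using Nat.strong_induction_on with
  | _ p ih =>
    intro hp
    rcases lt_or_ge p L with h | h
    · exact h0 p h
    rcases lt_or_ge p (L + m) with h' | h'
    · obtain ⟨j, rfl⟩ := Nat.exists_eq_add_of_le h
      have key : ∀ ρ : ℕ → Bool, conv m y ρ j = (conv (L + 1) y (trunc (L + j) ρ) j ^^ ρ (L + j)) :=
        fun ρ => by
          rw [conv_of_lt hy hL, ← conv_congr (σ := trunc (L + j + 1) ρ), conv_trunc_succ]
          · simp [hyL]
            omega
          · intro i hi
            simp [trunc]
            omega
      have h2 := hconv j (by omega)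
      rw [key, key, conv_congr (σ := trunc (L + j) σ) (τ := trunc (L + j) τ)] at h2
      · simpa using h2
      · intro i _
        by_cases hi : i < L + j
        · simp [trunc, hi, ih i hi (by omega)]
        · simp [trunc, hi]
    · exact h1 p h' hp

theorem exists_of_sum_choose_lt {m d : ℕ}
    (hm : ∑ i ∈ Finset.range d, (2 * m).choose i < 2 ^ m) : ∃ τ : ℕ → Bool,
    ∀ y, y ≠ 0 → y < 2 ^ m → d ≤ bitCount m y + Nat.count (fun j => conv m y τ j = true) m := by
  classical
  by_contra! H
  choose! y hy0 hy hlt using fun T : Finset ℕ => H fun p => decide (p ∈ T)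
  set τ : Finset ℕ → ℕ → Bool := fun T p => decide (p ∈ T) with hτ
  let D : Finset ℕ → Finset ℕ := fun T => (Finset.range (2 * m)).filter fun p =>
    (if p < m then (y T).testBit p else conv m (y T) (τ T) (p - m) : Bool) = true
  let R : Finset ℕ → Finset ℕ := fun T => (Finset.range m).filter fun q =>
    (if q < (y T).log2 then τ T q else τ T (q + m) : Bool) = true
  have hcard := Finset.card_le_card_of_injOn (s := (Finset.range (2 * m)).powerset)
    (t := ((Finset.range d).biUnion fun i => (Finset.range (2 * m)).powersetCard i) ×ˢ
      (Finset.range m).powerset) (fun T => (D T, R T)) ?_ ?_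
  · rw [Finset.card_product, Finset.card_powerset, Finset.card_powerset, Finset.card_range,
      Finset.card_range] at hcard
    have h1 : ((Finset.range d).biUnion fun i => (Finset.range (2 * m)).powersetCard i).card ≤
        ∑ i ∈ Finset.range d, (2 * m).choose i :=
      Finset.card_biUnion_le.trans (Finset.sum_le_sum fun i _ => by simp)
    have h2 := Nat.mul_lt_mul_of_pos_right (h1.trans_lt hm) (Nat.two_pow_pos m)
    rw [← pow_add, ← two_mul] at h2
    omega
  · intro T _
    rw [Finset.mem_coe, Finset.mem_product, Finset.mem_biUnion]
    refine ⟨⟨(D T).card, ?_, ?_⟩, ?_⟩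
    · rw [Finset.mem_range]
      refine lt_of_eq_of_lt ?_ (hlt T)
      rw [bitCount_eq_count, ← Nat.count_eq_card_filter_range, two_mul, Nat.count_add]
      congr 1
      · rw [Nat.count_eq_card_filter_range, Nat.count_eq_card_filter_range]
        congr 1
        refine Finset.filter_congr fun p hp => ?_
        rw [if_pos (Finset.mem_range.1 hp)]
      · simp [τ]
    · exact Finset.mem_powersetCard.2 ⟨Finset.filter_subset _ _, rfl⟩
    · exact Finset.mem_powerset.2 (Finset.filter_subset _ _)
  · intro T hT T' hT' h
    obtain ⟨hD, hR⟩ := Prod.mk.inj h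
    have hD' : ∀ p < 2 * m, (if p < m then (y T).testBit p else conv m (y T) (τ T) (p - m)) =
        if p < m then (y T').testBit p else conv m (y T') (τ T') (p - m) := fun p hp => by
      have := congrArg (p ∈ ·) hD
      simp only [D, Finset.mem_filter, Finset.mem_range, hp, true_and, eq_iff_iff] at this
      exact Bool.eq_iff_iff.2 this
    have hyy : y T = y T' := by
      refine Nat.eq_of_testBit_eq fun p => ?_
      rcases lt_or_ge p m with hp | hp
      · simpa [hp] using hD' p (by omega)
      · rw [Nat.testBit_eq_false_of_lt ((hy T).trans_le (Nat.pow_le_pow_right two_pos hp)),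
          Nat.testBit_eq_false_of_lt ((hy T').trans_le (Nat.pow_le_pow_right two_pos hp))]
    have hR' : ∀ q < m, (if q < (y T).log2 then τ T q else τ T (q + m)) =
        if q < (y T).log2 then τ T' q else τ T' (q + m) := fun q hq => by
      have := congrArg (q ∈ ·) hR
      simp only [R, Finset.mem_filter, Finset.mem_range, hq, true_and, eq_iff_iff, ← hyy] at this
      exact Bool.eq_iff_iff.2 this
    have hL : (y T).log2 < m := (Nat.log2_lt (hy0 T)).2 (hy T)
    have := eq_of_conv_eq (σ := τ T) (τ := τ T') hL Nat.lt_log2_self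
      (Nat.testBit_log2 (hy0 T)) (fun p hp => by simpa [hp] using hR' p (by omega))
      (fun p hp hp2 => by
        have := hR' (p - m) (by omega)
        rwa [if_neg (by omega), if_neg (by omega), Nat.sub_add_cancel (by omega)] at this)
      (fun j hj => by
        have := hD' (j + m) (by omega)
        rwa [if_neg (by omega), if_neg (by omega), Nat.add_sub_cancel, ← hyy] at this)
    ext p
    by_cases hp : p < 2 * m
    · exact decide_eq_decide.1 (this p hp)
    · have h1 : p ∉ T := fun h => hp (Finset.mem_range.1 (Finset.mem_powerset.1 hT h))
      have h2 : p ∉ T' := fun h => hp (Finset.mem_range.1 (Finset.mem_powerset.1 hT' h))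
      exact iff_of_false h1 h2

/-! ### Tables of codewords

A table with stride `S` holds words of `S` bits. -/

/-- The table of `s` copies of the word 1. -/
noncomputable def copies (S s : ℕ) : ℕ :=
  Nat.div (Nat.sub (Nat.pow 2 (Nat.mul S s)) 1) (Nat.sub (Nat.pow 2 S) 1)

/-- Append to the `s` words of `V` the `s'` words of `V'`, each of them combined with `r`. -/
noncomputable def append (S s V s' V' r : ℕ) : ℕ :=
  Nat.add V (Nat.shiftLeft (Nat.xor V' (Nat.mul r (copies S s'))) (Nat.mul S s))

/-- Apply `k` to the tables of the sums of `base` and one, two and three of the words of `rs`. -/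
noncomputable def tables (S base : ℕ) (rs : List ℕ) : (ℕ → ℕ → ℕ → ℕ → ℕ → ℕ → Bool) → Bool :=
  List.rec (motive := fun _ => (ℕ → ℕ → ℕ → ℕ → ℕ → ℕ → Bool) → Bool) (fun k => k 0 0 0 0 0 0)
    (fun r _ ih k => ih fun s₁ V₁ s₂ V₂ s₃ V₃ =>
      force (force (force (force (force (force k (Nat.succ s₁)) (append S s₁ V₁ 1 base r))
        (Nat.add s₂ s₁)) (append S s₂ V₂ s₁ V₁ r)) (Nat.add s₃ s₂)) (append S s₃ V₃ s₂ V₂ r)) rs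

noncomputable def bump (F : ℕ) (ms : List ℕ) : ℕ → List ℕ :=
  List.rec (motive := fun _ => ℕ → List ℕ) (fun _ => [])
    (fun a _ ih p => force (fun a' => a' :: ih a) (Nat.lor a (Nat.land p F))) ms

/-- Add the lowest `n` bits of the words in the table `V` to the counters `ms`: the `i`-th mask
marks the words with more than `i` ones. -/
noncomputable def masks (E n : ℕ) : ℕ → List ℕ → List ℕ :=
  Nat.rec (motive := fun _ => ℕ → List ℕ → List ℕ) (fun _ ms => ms)
    (fun _ ih V ms => force ih (Nat.shiftRight V 1) (bump V ms E)) n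

/-- Whether all words of the table `V` have weight more than `d`. -/
noncomputable def heavy (d S s V : ℕ) : Bool :=
  force (fun E => Nat.beq ((masks E S V (List.replicate (Nat.succ d) 0)).getD d 0) E) (copies S s)

noncomputable def check (S base : ℕ) (rs : List ℕ) : Bool :=
  tables S base rs fun s₁ V₁ s₂ V₂ s₃ V₃ =>
    heavy 8 S 1 base && (heavy 7 S s₁ V₁ && (heavy 6 S s₂ V₂ && heavy 5 S s₃ V₃))

/-- The words read off the first `m` bits of `A`, `A >>> 1`, … -/
noncomputable def rows (m n : ℕ) : ℕ → List ℕ :=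
  Nat.rec (motive := fun _ => ℕ → List ℕ) (fun _ => [])
    (fun _ ih A => force (fun r => r :: ih (Nat.shiftRight A 1)) (Nat.mod A (Nat.pow 2 m))) n

/-- The sum of the words of `rs` selected by the bits of `y`. -/
noncomputable def comb (rs : List ℕ) : ℕ → ℕ :=
  List.rec (motive := fun _ => ℕ → ℕ) (fun _ => 0)
    (fun r _ ih y => Nat.xor (Nat.mul (Nat.land y 1) r) (ih (Nat.shiftRight y 1))) rs

/-- Whether `comb Q` maps the words of `rs` to `p`, `2 * p`, … -/
noncomputable def linked (Q rs : List ℕ) : ℕ → Bool :=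
  List.rec (motive := fun _ => ℕ → Bool) (fun _ => true)
    (fun r _ ih p => Nat.beq (comb Q r) p && ih (Nat.mul 2 p)) rs

noncomputable def periodic (m a : ℕ) : ℕ := Nat.mul a (Nat.succ (Nat.pow 2 m))

noncomputable def cert (m a b : ℕ) : Bool :=
  linked (rows m m (periodic m b)) (rows m m (periodic m a)) 1 &&
    (check m a (rows m (Nat.sub m 1) (Nat.shiftRight (periodic m a) 1)) &&
      check m b (rows m (Nat.sub m 1) (Nat.shiftRight (periodic m b) 1)))

theorem copies_eq_sum {S : ℕ} (hS : 0 < S) (s : ℕ) :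
    copies S s = ∑ i ∈ Finset.range s, 2 ^ (S * i) := by
  have h : 2 ≤ 2 ^ S := Nat.le_self_pow (by omega) 2
  simp only [pow_mul, Nat.geomSum_eq h]
  rw [← pow_mul]
  rfl

theorem copies_succ {S : ℕ} (hS : 0 < S) (s : ℕ) :
    copies S (s + 1) = 2 ^ S * copies S s + 1 := by
  rw [copies_eq_sum hS, copies_eq_sum hS, Finset.sum_range_succ', Finset.mul_sum]
  congr 1
  refine Finset.sum_congr rfl fun i _ => ?_
  rw [← pow_add]
  ring_nf

theorem mul_copies_lt {S r : ℕ} (hS : 0 < S) (hr : r < 2 ^ S) (s : ℕ) :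
    r * copies S s < 2 ^ (S * s) := by
  induction s with
  | zero => simp [copies_eq_sum hS]
  | succ s ih =>
    rw [copies_succ hS, mul_add, mul_left_comm, mul_one, Nat.mul_succ, pow_add,
      mul_comm (2 ^ (S * s))]
    calc _ < 2 ^ S * (r * copies S s) + 2 ^ S := by omega
      _ = 2 ^ S * (r * copies S s + 1) := by ring
      _ ≤ _ := Nat.mul_le_mul_left _ ih

theorem testBit_mul_copies {S r s l j : ℕ} (hr : r < 2 ^ S) (hl : l < s) (hj : j < S) :
    (r * copies S s).testBit (S * l + j) = r.testBit j := by
  induction s generalizing l with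
  | zero => omega
  | succ s ih =>
    rw [copies_succ (by omega), mul_add, mul_left_comm, mul_one, Nat.testBit_two_pow_mul_add _ hr]
    cases l with
    | zero => simp [hj]
    | succ l =>
      rw [if_neg (by rw [Nat.mul_succ]; omega), ← ih (by omega : l < s)]
      congr 1
      rw [Nat.mul_succ]
      omega

/-- The number `V` is a table of `s` words, and it contains the words that satisfy `P`. -/
def IsTable (S s V : ℕ) (P : ℕ → Prop) : Prop :=
  V < 2 ^ (S * s) ∧ ∀ w, P w → ∃ l < s, ∀ j < S, V.testBit (S * l + j) = w.testBit j

theorem IsTable.append {S s V s' V' r : ℕ} {P P' Q : ℕ → Prop} (hS : 0 < S)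
    (h : IsTable S s V P) (h' : IsTable S s' V' P') (hr : r < 2 ^ S)
    (hQ : ∀ w, Q w → P w ∨ P' (r ^^^ w)) : IsTable S (s + s') (append S s V s' V' r) Q := by
  have e : Sieve.append S s V s' V' r = 2 ^ (S * s) * (V' ^^^ r * copies S s') + V := by
    rw [mul_comm, ← Nat.shiftLeft_eq, add_comm]
    rfl
  rw [IsTable, e]
  constructor
  · have h1 := Nat.xor_lt_two_pow h'.1 (mul_copies_lt hS hr s')
    rw [mul_add, pow_add]
    calc _ < 2 ^ (S * s) * (V' ^^^ r * copies S s') + 2 ^ (S * s) := by have := h.1; omega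
      _ = 2 ^ (S * s) * ((V' ^^^ r * copies S s') + 1) := by ring
      _ ≤ _ := Nat.mul_le_mul_left _ h1
  · intro w hw
    rcases hQ w hw with hw | hw
    · obtain ⟨l, hl, hl'⟩ := h.2 w hw
      refine ⟨l, by omega, fun j hj => ?_⟩
      have : S * l + j < S * s := by nlinarith
      rw [Nat.testBit_two_pow_mul_add _ h.1, if_pos this, hl' j hj]
    · obtain ⟨l, hl, hl'⟩ := h'.2 _ hw
      refine ⟨s + l, by omega, fun j hj => ?_⟩
      rw [Nat.testBit_two_pow_mul_add _ h.1, if_neg (by rw [mul_add]; omega), mul_add, add_assoc,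
        Nat.add_sub_cancel_left, Nat.testBit_xor, hl' j hj, testBit_mul_copies hr hl hj,
        Nat.testBit_xor]
      cases r.testBit j <;> simp

theorem comb_cons (r : ℕ) (rs : List ℕ) (y : ℕ) :
    comb (r :: rs) y = ((y &&& 1) * r ^^^ comb rs (y >>> 1)) := rfl

theorem bitCount_succ (n y : ℕ) : bitCount (n + 1) y = (y &&& 1) + bitCount n (y >>> 1) := rfl

theorem comb_eq_zero (rs : List ℕ) {y : ℕ} (hy : bitCount rs.length y = 0) : comb rs y = 0 := by
  induction rs generalizing y with
  | nil => rfl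
  | cons r rs ih =>
    rw [List.length_cons, bitCount_succ] at hy
    rw [comb_cons, ih (by omega), (by omega : y &&& 1 = 0)]
    simp

/-- `w` is the sum of `base` and `k` of the words of `rs`. -/
def IsSum (base : ℕ) (rs : List ℕ) (k w : ℕ) : Prop :=
  ∃ y, bitCount rs.length y = k ∧ w = base ^^^ comb rs y

theorem IsSum.of_cons {base r : ℕ} {rs : List ℕ} {k w : ℕ} (h : IsSum base (r :: rs) (k + 1) w) :
    IsSum base rs (k + 1) w ∨ IsSum base rs k (r ^^^ w) := by
  obtain ⟨y, hy, rfl⟩ := h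
  rw [List.length_cons, bitCount_succ, Nat.and_one_is_mod] at hy
  rw [comb_cons, Nat.and_one_is_mod]
  rcases Nat.mod_two_eq_zero_or_one y with h | h
  · exact Or.inl ⟨y >>> 1, by omega, by simp [h]⟩
  · exact Or.inr ⟨y >>> 1, by omega, by
      rw [h, one_mul, Nat.xor_left_comm, Nat.xor_xor_cancel_left]⟩

theorem isTable_singleton {S base : ℕ} (hb : base < 2 ^ S) (rs : List ℕ) :
    IsTable S 1 base (IsSum base rs 0) := by
  refine ⟨by rwa [mul_one], ?_⟩
  rintro w ⟨y, hy, rfl⟩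
  exact ⟨0, one_pos, fun j _ => by simp [comb_eq_zero rs hy]⟩

theorem exists_of_tables {S base : ℕ} {rs : List ℕ} (hS : 0 < S) (hb : base < 2 ^ S)
    (hrs : ∀ r ∈ rs, r < 2 ^ S) {k : ℕ → ℕ → ℕ → ℕ → ℕ → ℕ → Bool} (h : tables S base rs k = true) :
    ∃ s₁ V₁ s₂ V₂ s₃ V₃, IsTable S s₁ V₁ (IsSum base rs 1) ∧ IsTable S s₂ V₂ (IsSum base rs 2) ∧
      IsTable S s₃ V₃ (IsSum base rs 3) ∧ k s₁ V₁ s₂ V₂ s₃ V₃ = true := by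
  induction rs generalizing k with
  | nil =>
    have key : ∀ k, k ≠ 0 → IsTable S 0 0 (IsSum base [] k) := fun k hk =>
      ⟨by simp, fun w ⟨y, hy, _⟩ => absurd hy.symm hk⟩
    exact ⟨0, 0, 0, 0, 0, 0, key 1 (by omega), key 2 (by omega), key 3 (by omega), h⟩
  | cons r rs ih =>
    obtain ⟨hr, hrs⟩ := List.forall_mem_cons.1 hrs
    obtain ⟨s₁, V₁, s₂, V₂, s₃, V₃, h1, h2, h3, h⟩ := ih hrs h
    simp only [force_eq] at h
    exact ⟨_, _, _, _, _, _, h1.append hS (isTable_singleton hb rs) hr fun w => IsSum.of_cons,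
      h2.append hS h1 hr fun w => IsSum.of_cons, h3.append hS h2 hr fun w => IsSum.of_cons, h⟩

theorem testBit_bump {p c : ℕ} {F : ℕ} {ms : List ℕ} {E : ℕ} {d : ℕ}
    (hE : E.testBit p → d ≤ c) (h : ∀ i, (ms.getD i 0).testBit p → d + i + 1 ≤ c) (i : ℕ)
    (hi : ((bump F ms E).getD i 0).testBit p) : d + i + 1 ≤ c + (F.testBit p).toNat := by
  induction ms generalizing E d i with
  | nil => simp [bump] at hi
  | cons a ms ih =>
    have e : bump F (a :: ms) E = (a ||| E &&& F) :: bump F ms a :=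
      force_eq (fun a' => a' :: bump F ms a) (a ||| E &&& F)
    rw [e] at hi
    cases i with
    | zero =>
      rw [List.getD_cons_zero, Nat.testBit_or, Nat.testBit_and, Bool.or_eq_true,
        Bool.and_eq_true] at hi
      rcases hi with hi | ⟨hi, hF⟩
      · have := h 0 hi
        omega
      · have := hE hi
        simp [hF, this]
    | succ i =>
      have := ih (d := d + 1) (E := a) (fun ha => h 0 ha)
        (fun i hi => by have := h (i + 1) hi; omega) i hi
      omega

theorem testBit_masks {p c E n V : ℕ} {ms : List ℕ}
    (h : ∀ i, (ms.getD i 0).testBit p → i + 1 ≤ c) (i : ℕ)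
    (hi : ((masks E n V ms).getD i 0).testBit p) :
    i + 1 ≤ c + Nat.count (fun j => V.testBit (p + j) = true) n := by
  induction n generalizing V c ms with
  | zero => exact h i hi
  | succ n ih =>
    have e : masks E (n + 1) V ms = masks E n (V >>> 1) (bump V ms E) :=
      congrFun (force_eq _ _) _
    rw [e] at hi
    have := ih (c := c + (V.testBit p).toNat) (fun i hi => by
      have := testBit_bump (d := 0) (c := c) (fun _ => Nat.zero_le _)
        (fun i hi => by have := h i hi; omega) i hi
      omega) hi
    rw [Nat.count_succ']
    simp only [Nat.testBit_shiftRight] at this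
    have e2 : (V.testBit p).toNat = if V.testBit (p + 0) = true then 1 else 0 := by
      rw [add_zero]; cases V.testBit p <;> rfl
    rw [← e2]
    have e3 : ∀ j, 1 + (p + j) = p + (j + 1) := fun j => by omega
    simp only [e3] at this
    omega

theorem lt_count_of_heavy {d S s V : ℕ} {P : ℕ → Prop} (hS : 0 < S)
    (h : heavy d S s V = true) (hV : IsTable S s V P) {w : ℕ} (hw : P w) :
    d < Nat.count (fun j => w.testBit j = true) S := by
  obtain ⟨l, hl, hl'⟩ := hV.2 w hw
  rw [heavy, force_eq] at h
  have h := Nat.eq_of_beq_eq_true h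
  have h1 : (copies S s).testBit (S * l) = true := by
    have := testBit_mul_copies (r := 1) (Nat.one_lt_two_pow (by omega)) hl hS
    rwa [one_mul] at this
  rw [← h] at h1
  have h2 := testBit_masks (c := 0) (fun i hi => by
    simp [List.getD_eq_getElem?_getD, List.getElem?_getD_replicate_default_eq] at hi) _ h1
  rw [zero_add] at h2
  refine h2.trans_eq ?_
  rw [Nat.count_eq_card_filter_range, Nat.count_eq_card_filter_range]
  congr 1
  exact Finset.filter_congr fun j hj => by rw [hl' j (Finset.mem_range.1 hj)]

theorem le_of_check {S base : ℕ} {rs : List ℕ} (hS : 0 < S) (hb : base < 2 ^ S)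
    (hrs : ∀ r ∈ rs, r < 2 ^ S) (h : check S base rs = true) {y : ℕ}
    (hy : bitCount rs.length y ≤ 3) : 9 ≤ bitCount rs.length y +
      Nat.count (fun j => (base ^^^ comb rs y).testBit j = true) S := by
  obtain ⟨s₁, V₁, s₂, V₂, s₃, V₃, h1, h2, h3, h⟩ := exists_of_tables hS hb hrs h
  simp only [Bool.and_eq_true] at h
  obtain ⟨k, hk⟩ : ∃ k, bitCount rs.length y = k := ⟨_, rfl⟩
  have hw : IsSum base rs k (base ^^^ comb rs y) := ⟨y, hk, rfl⟩
  rw [hk] at hy ⊢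
  interval_cases k
  · have := lt_count_of_heavy hS h.1 (isTable_singleton hb rs) hw
    omega
  · have := lt_count_of_heavy hS h.2.1 h1 hw
    omega
  · have := lt_count_of_heavy hS h.2.2.1 h2 hw
    omega
  · have := lt_count_of_heavy hS h.2.2.2 h3 hw
    omega

/-! ### Double circulant codes -/

theorem rows_succ (m n A : ℕ) : rows m (n + 1) A = A % 2 ^ m :: rows m n (A >>> 1) :=
  force_eq (fun r => r :: rows m n (A >>> 1)) (A % 2 ^ m)

theorem length_rows (m n A : ℕ) : (rows m n A).length = n := by
  induction n generalizing A with
  | zero => rfl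
  | succ n ih => rw [rows_succ, List.length_cons, ih]

theorem lt_of_mem_rows {m n A r : ℕ} (hr : r ∈ rows m n A) : r < 2 ^ m := by
  induction n generalizing A with
  | zero => cases hr
  | succ n ih =>
    rw [rows_succ] at hr
    rcases List.mem_cons.1 hr with rfl | hr
    exacts [Nat.mod_lt _ (Nat.two_pow_pos m), ih hr]

theorem comb_lt {m : ℕ} {rs : List ℕ} (hrs : ∀ r ∈ rs, r < 2 ^ m) (y : ℕ) : comb rs y < 2 ^ m := by
  induction rs generalizing y with
  | nil => exact Nat.two_pow_pos m
  | cons r rs ih =>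
    obtain ⟨hr, hrs⟩ := List.forall_mem_cons.1 hrs
    refine Nat.xor_lt_two_pow (lt_of_le_of_lt ?_ hr) (ih hrs _)
    exact (Nat.mul_le_mul_right r Nat.and_le_right).trans_eq (one_mul r)

theorem testBit_and_one_mul (y r j : ℕ) :
    ((y &&& 1) * r).testBit j = (y.testBit 0 && r.testBit j) := by
  rw [Nat.and_one_is_mod, Nat.testBit_zero]
  rcases Nat.mod_two_eq_zero_or_one y with h | h <;> simp [h]

theorem testBit_comb_rows {m j : ℕ} (hj : j < m) (n A y : ℕ) :
    (comb (rows m n A) y).testBit j = conv n y A.testBit j := by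
  induction n generalizing A y with
  | zero => simp [rows, comb, conv]
  | succ n ih =>
    have e : (A >>> 1).testBit = fun i => A.testBit (i + 1) := by
      ext i
      rw [Nat.testBit_shiftRight, add_comm]
    rw [rows_succ, comb_cons, Nat.testBit_xor, ih, conv, e, conv_add, testBit_and_one_mul,
      Nat.testBit_mod_two_pow, decide_eq_true hj, Bool.true_and]

theorem comb_xor (rs : List ℕ) (x y : ℕ) : comb rs (x ^^^ y) = comb rs x ^^^ comb rs y := by
  induction rs generalizing x y with
  | nil => simp [comb]
  | cons r rs ih =>
    rw [comb_cons, comb_cons, comb_cons, Nat.shiftRight_xor_distrib, ih]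
    refine Nat.eq_of_testBit_eq fun j => ?_
    simp only [Nat.testBit_xor, testBit_and_one_mul]
    cases x.testBit 0 <;> cases y.testBit 0 <;> cases r.testBit j <;> simp

theorem comb_zero (rs : List ℕ) : comb rs 0 = 0 := by
  induction rs with
  | nil => rfl
  | cons r rs ih => rw [comb_cons]; simpa using ih

theorem comb_comb_of_linked {Q rs : List ℕ} {a : ℕ} (h : linked Q rs (2 ^ a) = true) {y : ℕ}
    (hy : y < 2 ^ rs.length) : comb Q (comb rs y) = 2 ^ a * y := by
  induction rs generalizing a y with
  | nil =>
    obtain rfl : y = 0 := by simpa using hy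
    exact comb_zero Q
  | cons r rs ih =>
    have h : (Nat.beq (comb Q r) (2 ^ a) && linked Q rs (2 * 2 ^ a)) = true := h
    rw [Bool.and_eq_true, ← pow_succ'] at h
    have hr := Nat.eq_of_beq_eq_true h.1
    rw [comb_cons, comb_xor, ih h.2 (by
      rw [List.length_cons] at hy; rw [Nat.shiftRight_eq_div_pow]; omega),
      Nat.and_one_is_mod, Nat.shiftRight_eq_div_pow, pow_one]
    refine Nat.eq_of_testBit_eq fun j => ?_
    obtain ⟨z, hz⟩ : ∃ z, y / 2 = z := ⟨_, rfl⟩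
    rcases Nat.mod_two_eq_zero_or_one y with h2 | h2
    · obtain rfl : y = 2 * z := by omega
      rw [h2, zero_mul, comb_zero, Nat.zero_xor, hz, pow_succ, mul_assoc]
    · obtain rfl : y = 2 * z + 1 := by omega
      rw [h2, one_mul, hr, hz, Nat.testBit_xor, mul_add, mul_one, ← mul_assoc, ← pow_succ,
        Nat.testBit_two_pow_mul_add _ (Nat.pow_lt_pow_right one_lt_two (Nat.lt_succ_self a)),
        Nat.testBit_two_pow, Nat.testBit_two_pow_mul]
      split_ifs with h3
      · simp [not_le.2 h3]
      · have : a ≠ j := by omega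
        simp [this, not_lt.1 h3]

theorem testBit_periodic {m a p : ℕ} (ha : a < 2 ^ m) (hp : p < 2 * m) :
    (periodic m a).testBit p = a.testBit (p % m) := by
  have e : periodic m a = 2 ^ m * a + a := by
    change a * (2 ^ m + 1) = _
    ring
  rw [e, Nat.testBit_two_pow_mul_add _ ha]
  split_ifs with h
  · rw [Nat.mod_eq_of_lt h]
  · rw [Nat.mod_eq_sub_mod (not_lt.1 h), Nat.mod_eq_of_lt (by omega)]

theorem conv_periodic {m a j : ℕ} (ha : a < 2 ^ m) (hj : j < m) (y : ℕ) :
    conv m y (periodic m a).testBit j = conv m y (fun p => a.testBit (p % m)) j :=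
  conv_congr y fun p hp => testBit_periodic ha (by omega)

theorem weight_of_odd {m a y : ℕ} (hm : 0 < m) (ha : a < 2 ^ m)
    (h : check m a (rows m (m - 1) (periodic m a >>> 1)) = true) (hy : bitCount m y ≤ 4)
    (h1 : y.testBit 0 = true) : 10 ≤ bitCount m y +
      Nat.count (fun j => conv m y (fun p => a.testBit (p % m)) j = true) m := by
  obtain ⟨n, rfl⟩ := Nat.exists_eq_add_of_le' hm
  rw [Nat.add_sub_cancel] at h
  have e1 : y &&& 1 = 1 := by
    rw [Nat.and_one_is_mod]
    simpa using h1
  have e2 : periodic (n + 1) a % 2 ^ (n + 1) = a := by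
    refine Nat.eq_of_testBit_eq fun j => ?_
    rw [Nat.testBit_mod_two_pow]
    by_cases hj : j < n + 1
    · rw [decide_eq_true hj, Bool.true_and, testBit_periodic ha (by omega), Nat.mod_eq_of_lt hj]
    · rw [decide_eq_false hj, Bool.false_and, Nat.testBit_eq_false_of_lt
        (ha.trans_le (Nat.pow_le_pow_right two_pos (not_lt.1 hj)))]
  rw [bitCount_succ, e1] at hy ⊢
  have := le_of_check hm ha (fun r => lt_of_mem_rows) h (y := y >>> 1) (by rw [length_rows]; omega)
  rw [length_rows] at this
  refine (Nat.add_le_add_left this 1).trans_eq ?_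
  rw [← add_assoc]
  congr 1
  rw [Nat.count_eq_card_filter_range, Nat.count_eq_card_filter_range]
  congr 1
  refine Finset.filter_congr fun j hj => ?_
  rw [← conv_periodic ha (Finset.mem_range.1 hj), ← testBit_comb_rows (Finset.mem_range.1 hj),
    rows_succ, comb_cons, e1, e2, one_mul]

theorem weight_of_check {m a y : ℕ} (ha : a < 2 ^ m)
    (h : check m a (rows m (m - 1) (periodic m a >>> 1)) = true) (hy : bitCount m y ≤ 4)
    (h0 : y ≠ 0) (hym : y < 2 ^ m) : 10 ≤ bitCount m y +
      Nat.count (fun j => conv m y (fun p => a.testBit (p % m)) j = true) m := by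
  obtain ⟨i, z, hz, rfl⟩ := Nat.exists_eq_two_pow_mul_odd h0
  have hz0 : z.testBit 0 = true := by rw [Nat.testBit_zero, Nat.odd_iff.1 hz]; rfl
  have hi : i < m := (Nat.pow_lt_pow_iff_right one_lt_two).1
    ((Nat.le_mul_of_pos_right _ hz.pos).trans_lt hym)
  obtain ⟨n, rfl⟩ := Nat.exists_eq_add_of_le' hi.le
  have hzn : z < 2 ^ n := by
    rw [pow_add, mul_comm] at hym
    exact Nat.lt_of_mul_lt_mul_right hym
  have e : 2 ^ i * z = z <<< i := by rw [Nat.shiftLeft_eq, mul_comm]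
  rw [e, bitCount_shiftLeft, ← bitCount_of_lt hzn (Nat.le_add_right n i)] at hy ⊢
  refine (weight_of_odd (by omega) ha h hy hz0).trans_eq ?_
  simp only [conv_shiftLeft]
  congr 1
  set g : ℕ → Bool := fun j => conv (n + i) z (fun p => a.testBit (p % (n + i))) j with hg
  have hgp : Function.Periodic (fun j => g j = true) (n + i) := fun j => by
    simp only [hg]
    rw [← conv_add]
    simp
  rw [← Nat.filter_Ico_card_eq_of_periodic i (n + i) _ hgp, Nat.count_eq_card_filter_range]
  simp only [hg, conv_of_lt hzn (Nat.le_add_right n i)]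
  symm
  rw [← Finset.card_map (addRightEmbedding i)]
  congr 1
  ext j
  simp
  constructor
  · rintro ⟨j, ⟨h1, h2⟩, rfl⟩
    exact ⟨⟨by omega, by omega⟩, h2⟩
  · rintro ⟨⟨h1, h2⟩, h3⟩
    exact ⟨j - i, ⟨by omega, by rwa [Nat.sub_add_cancel h1]⟩, by omega⟩

theorem exists_of_cert {m a b : ℕ} (ha : a < 2 ^ m) (hb : b < 2 ^ m) (h : cert m a b = true) :
    ∃ τ : ℕ → Bool, ∀ y, y ≠ 0 → y < 2 ^ m →
      10 ≤ bitCount m y + Nat.count (fun j => conv m y τ j = true) m := by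
  rw [cert, Bool.and_eq_true, Bool.and_eq_true] at h
  obtain ⟨h1, h2, h3⟩ := h
  refine ⟨fun p => a.testBit (p % m), fun y h0 hy => ?_⟩
  rcases le_or_gt (bitCount m y) 4 with h4 | h4
  · exact weight_of_check ha h2 h4 h0 hy
  set w := comb (rows m m (periodic m a)) y with hw
  have hwm : w < 2 ^ m := comb_lt (fun r => lt_of_mem_rows) y
  have hwy : comb (rows m m (periodic m b)) w = y := by
    rw [hw, comb_comb_of_linked (a := 0) h1 (by rwa [length_rows]), pow_zero, one_mul]
  have ew : bitCount m w = Nat.count (fun j => conv m y (fun p => a.testBit (p % m)) j = true) m := by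
    rw [bitCount_eq_count, Nat.count_eq_card_filter_range, Nat.count_eq_card_filter_range]
    congr 1
    exact Finset.filter_congr fun j hj => by
      rw [hw, testBit_comb_rows (Finset.mem_range.1 hj), conv_periodic ha (Finset.mem_range.1 hj)]
  have ey : bitCount m y = Nat.count (fun j => conv m w (fun p => b.testBit (p % m)) j = true) m := by
    rw [bitCount_eq_count, Nat.count_eq_card_filter_range, Nat.count_eq_card_filter_range]
    congr 1
    exact Finset.filter_congr fun j hj => by
      rw [← conv_periodic hb (Finset.mem_range.1 hj), ← testBit_comb_rows (Finset.mem_range.1 hj),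
        hwy]
  rw [← ew]
  rcases le_or_gt (bitCount m w) 4 with h5 | h5
  · rw [ey, add_comm]
    exact weight_of_check hb h3 h5 (fun h => h0 (by rw [← hwy, h, comb_zero])) hwm
  · omega

theorem cert_21 : cert 21 6523 519978 = true := by decide +kernel

theorem cert_22 : cert 22 5099 2632629 = true := by decide +kernel

theorem cert_23 : cert 23 5047 5520011 = true := by decide +kernel

theorem cert_24 : cert 24 14249035 12219697 = true := by decide +kernel

theorem cert_25 : cert 25 5809610 16450420 = true := by decide +kernel

theorem cert_26 : cert 26 43550887 35702424 = true := by decide +kernel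

theorem cert_27 : cert 27 18353683 126625871 = true := by decide +kernel

theorem cert_28 : cert 28 86673915 100177069 = true := by decide +kernel

theorem cert_29 : cert 29 20868964 7968781 = true := by decide +kernel

theorem cert_30 : cert 30 961535303 76245870 = true := by decide +kernel

theorem cert_31 : cert 31 62768171 752592287 = true := by decide +kernel

theorem cert_32 : cert 32 1717731999 2144665368 = true := by decide +kernel

theorem cert_33 : cert 33 1505789007 3009973647 = true := by decide +kernel

theorem cert_34 : cert 34 5338609790 15148693378 = true := by decide +kernel

theorem cert_35 : cert 35 32825090255 11910284788 = true := by decide +kernel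

theorem cert_36 : cert 36 24158637401 17863977901 = true := by decide +kernel

theorem cert_37 : cert 37 113248686419 52585903815 = true := by decide +kernel

theorem exists_of_lt {m : ℕ} (hm : 20 < m) : ∃ τ : ℕ → Bool, ∀ y, y ≠ 0 → y < 2 ^ m →
    10 ≤ bitCount m y + Nat.count (fun j => conv m y τ j = true) m := by
  rcases le_or_gt 38 m with h | h
  · exact exists_of_sum_choose_lt (sum_choose_lt h)
  interval_cases m
  exacts [exists_of_cert (by norm_num) (by norm_num) cert_21,
    exists_of_cert (by norm_num) (by norm_num) cert_22,
    exists_of_cert (by norm_num) (by norm_num) cert_23,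
    exists_of_cert (by norm_num) (by norm_num) cert_24,
    exists_of_cert (by norm_num) (by norm_num) cert_25,
    exists_of_cert (by norm_num) (by norm_num) cert_26,
    exists_of_cert (by norm_num) (by norm_num) cert_27,
    exists_of_cert (by norm_num) (by norm_num) cert_28,
    exists_of_cert (by norm_num) (by norm_num) cert_29,
    exists_of_cert (by norm_num) (by norm_num) cert_30,
    exists_of_cert (by norm_num) (by norm_num) cert_31,
    exists_of_cert (by norm_num) (by norm_num) cert_32,
    exists_of_cert (by norm_num) (by norm_num) cert_33,
    exists_of_cert (by norm_num) (by norm_num) cert_34,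
    exists_of_cert (by norm_num) (by norm_num) cert_35,
    exists_of_cert (by norm_num) (by norm_num) cert_36,
    exists_of_cert (by norm_num) (by norm_num) cert_37]

end Sieve

/-- Existence of a double Toeplitz code of length 2m over the field with 2
elements having minimum weight at least 10, characterized by the length. -/
theorem stmt14 (m : ℕ) (hm : 1 ≤ m) :
    (∃ A : Matrix (Fin m) (Fin m) (ZMod 2), IsToeplitz A ∧
        ∀ c ∈ DTcode A, c ≠ 0 → 10 ≤ wt c) ↔ (42 ≤ 2 * m) := by
  rw [Sieve.exists_code_iff]
  constructor
  · rintro ⟨τ, hτ⟩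
    have := Sieve.lt_of_forall_le_weight hm hτ
    omega
  · intro h
    exact Sieve.exists_of_lt (by omega)
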